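/- arXiv:1602.08792 — 3 statements merged into one kernel-verified Lean document; each statement's English description precedes it below -/
import Mathlib

section
/- Let $w = y_t \cdots y_1 x_t \cdots x_1$ be a double-row word, i.e., compatible with the rectangular partition shape $(t,t)$: $x_t \leq \cdots \leq x_1$, $y_t \leq \cdots \leq y_1$, and $x_i < y_i$ for each $i$. Let $T$ be a semistandard tableau of partition shape. For $1 \leq k \leq t$ let $R^x_k$ be the row index of the new box when $x_k$ is column-inserted into $[x_{k-1}\cdots x_1 \to T]$ and $R^y_k$ the row index of the new box when $y_k$ is column-inserted into $[y_{k-1}\cdots y_1 x_t \cdots x_1 \to T]$. Then the word $R^y_t \cdots R^y_1 R^x_t \cdots R^x_1$ is a double-row, i.e., $R^x_t \leq \cdots \leq R^x_1$, $R^y_t \leq \cdots \leq R^y_1$, and $R^x_i < R^y_i$ for each $i$. -/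
namespace DK

/-- `l` is a partition: weakly decreasing list of positive parts. -/
def IsPartition (l : List ℕ) : Prop :=
  List.Chain' (fun a b => b ≤ a) l ∧ ∀ x ∈ l, 0 < x

/- ## Column insertion, tableaux as lists of columns -/

/-- Insert a letter into a single (strictly increasing) column, returning the
bumped letter (if any) and the new column. -/
def insertCol (a : ℕ) : List ℕ → Option ℕ × List ℕ
  | [] => (none, [a])
  | x :: xs =>
      if a ≤ x then (some x, a :: xs)
      else
        let r := insertCol a xs
        (r.1, x :: r.2)

/-- Column insertion `[a → T]` for a tableau `T` given as its list of columns. -/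
def colInsert (a : ℕ) : List (List ℕ) → List (List ℕ)
  | [] => [[a]]
  | c :: cs =>
      match insertCol a c with
      | (none, c') => c' :: cs
      | (some b, c') => c' :: colInsert b cs

/-- `R(a → T)`: the (1-indexed) row in which the new box appears in `[a → T]`. -/
def newRow (a : ℕ) : List (List ℕ) → ℕ
  | [] => 1
  | c :: cs =>
      match insertCol a c with
      | (none, _) => c.length + 1
      | (some b, _) => newRow b cs

/-- Insert the letters of a word into `T`, the head of the list first (our word
lists are in reading order: the head is the first letter read, which is the
first letter inserted in `[w → T]`). -/
def insertList : List ℕ → List (List ℕ) → List (List ℕ)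
  | [], T => T
  | a :: rest, T => insertList rest (colInsert a T)

def sigmaWordAux : List (List ℕ) → List ℕ → List ℕ
  | _, [] => []
  | T, a :: rest => newRow a T :: sigmaWordAux (colInsert a T) rest

/-- The word `σ(T) = b_N ⋯ b_1` of row indices of the new boxes in the column
insertion of the word `w` into the empty tableau, in the same positional
encoding as `w` itself. -/
def sigmaWord (w : List ℕ) : List ℕ := sigmaWordAux [] w

/-- Iterated insertion of `a 1, a 2, …, a k` into `T`. -/
def insertUpTo (a : ℕ → ℕ) (T : List (List ℕ)) : ℕ → List (List ℕ)
  | 0 => T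
  | k+1 => colInsert (a (k+1)) (insertUpTo a T k)

/-- `T` (a list of columns) is a semistandard tableau of partition shape with
positive entries: columns strictly increasing, column lengths weakly
decreasing, rows weakly increasing. -/
structure IsColTab (T : List (List ℕ)) : Prop where
  ne : ∀ c ∈ T, c ≠ ([] : List ℕ)
  pos : ∀ c ∈ T, ∀ x ∈ c, 0 < x
  colStrict : ∀ c ∈ T, List.Chain' (· < ·) c
  lenDecr : List.Chain' (fun a b => b ≤ a) (T.map List.length)
  rowWeak : ∀ j i, i < (T.getD (j+1) []).length →
      (T.getD j []).getD i 0 ≤ (T.getD (j+1) []).getD i 0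

/- ## Charge (Lascoux–Schützenberger) -/

/-- Reading leftwards (cyclically) from position `start` in `w`, the position
of the first occurrence of the letter `t`. -/
def chooseNext (w : List ℕ) (start t : ℕ) : Option ℕ :=
  let occ := (List.range w.length).filter (fun p => w.getD p 0 = t)
  ((occ.filter (fun p => p < start)).max?) <|> ((occ.filter (fun p => start < p)).max?)

def extractAux (w : List ℕ) : ℕ → ℕ → ℕ → List ℕ
  | 0, _, _ => []
  | fuel+1, start, t =>
      match chooseNext w start t with
      | none => []
      | some p => p :: extractAux w fuel p (t+1)

/-- Positions of the first extracted standard subword of `w`. -/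
def extract (w : List ℕ) : List ℕ :=
  extractAux w w.length w.length 1

def chargeIdxAux : ℕ → ℕ → List ℕ → ℕ
  | _, _, [] => 0
  | idx, prev, p :: ps =>
      let idx' := if p < prev then idx + 1 else idx
      idx' + chargeIdxAux idx' p ps

/-- Charge of a standard subword given by the positions of its letters
`1, 2, …`: the letter `1` has index `0`, and the letter `r+1` has the index of
`r`, increased by one exactly when `r+1` lies to the left of `r`. -/
def chargePos : List ℕ → ℕ
  | [] => 0
  | p :: ps => chargeIdxAux 0 p ps

def removePositions (w : List ℕ) (ps : List ℕ) : List ℕ :=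
  ((List.range w.length).filter (fun p => p ∉ ps)).map (fun p => w.getD p 0)

def chargeFuel : ℕ → List ℕ → ℕ
  | 0, _ => 0
  | fuel+1, w =>
      if w.isEmpty then 0
      else
        let ps := extract w
        chargePos ps + chargeFuel fuel (removePositions w ps)

/-- The charge of a word of partition weight, obtained by repeatedly extracting
standard subwords and summing their charges. -/
def charge (w : List ℕ) : ℕ := chargeFuel w.length w

/-- The word `w` has positive letters and partition weight. -/
def HasPartitionWeight (w : List ℕ) : Prop :=
  (∀ x ∈ w, 0 < x) ∧ ∀ i, 1 ≤ i → w.count (i+1) ≤ w.count i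

/- ## Knuth equivalence -/

/-- Elementary Knuth transformations. -/
inductive KnuthStep : List ℕ → List ℕ → Prop
  | k1 (u v : List ℕ) (x y z : ℕ) (hxy : x ≤ y) (hyz : y < z) :
      KnuthStep (u ++ x :: z :: y :: v) (u ++ z :: x :: y :: v)
  | k2 (u v : List ℕ) (x y z : ℕ) (hxy : x < y) (hyz : y ≤ z) :
      KnuthStep (u ++ y :: z :: x :: v) (u ++ y :: x :: z :: v)

/-- Knuth equivalence: the equivalence relation generated by the elementary
Knuth transformations. -/
def KnuthEquiv : List ℕ → List ℕ → Prop := Relation.EqvGen KnuthStep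

/- ## Skew tableaux as functions `ℕ → ℕ → ℕ` (`0` = empty box) -/

/-- `f` is a semistandard skew tableau of shape `lam - rho` (row `i` occupies
columns `rho_i ≤ j < lam_i`, everything 0-indexed): the support is exactly the
skew shape, rows weakly increase and columns strictly increase. -/
def IsSkewFn (lam rho : List ℕ) (f : ℕ → ℕ → ℕ) : Prop :=
  (∀ i j, f i j ≠ 0 ↔ (rho.getD i 0 ≤ j ∧ j < lam.getD i 0)) ∧
  (∀ i j j', rho.getD i 0 ≤ j → j ≤ j' → j' < lam.getD i 0 → f i j ≤ f i j') ∧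
  (∀ i j, f i j ≠ 0 → f (i+1) j ≠ 0 → f i j < f (i+1) j)

/-- The (row-)reading word of `f`, within the bounding box `R × C`: letters are
read right to left in successive rows, starting with the top row; the head of
the list is the first letter read. -/
def readWordF (R C : ℕ) (f : ℕ → ℕ → ℕ) : List ℕ :=
  ((List.range R).map (fun i =>
    ((List.range C).reverse.map (f i)).filter (fun x => x ≠ 0))).flatten

/-- The word `w` has weight `mu`: the letter `i+1` occurs `mu_i` times. -/
def wtEq (w : List ℕ) (mu : List ℕ) : Prop := ∀ i, w.count (i+1) = mu.getD i 0

/-- `w` is a lattice permutation: in each final segment of the reading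
(i.e. each suffix of the list), `i` occurs at least as often as `i+1`. -/
def IsLattice (w : List ℕ) : Prop :=
  ∀ k i, 1 ≤ i → (w.drop k).count (i+1) ≤ (w.drop k).count i

/- ## Jeu de taquin -/

/-- Update a two-variable function at one point. -/
def upd (f : ℕ → ℕ → ℕ) (i j v : ℕ) : ℕ → ℕ → ℕ :=
  fun i' j' => if i' = i ∧ j' = j then v else f i' j'

/-- One upper jeu de taquin slide: the pawn starts at `(i, j)` and repeatedly
exchanges with the smaller of the letters to its right and below it (the one
below in case of ties), until neither exists.  Returns the resulting tableau
together with the final position of the hole. -/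
def slideU : ℕ → (ℕ → ℕ → ℕ) → ℕ → ℕ → ((ℕ → ℕ → ℕ) × ℕ × ℕ)
  | 0, f, i, j => (f, i, j)
  | fuel+1, f, i, j =>
      let r := f i (j+1)
      let b := f (i+1) j
      if b = 0 ∧ r = 0 then (f, i, j)
      else if b ≠ 0 ∧ (r = 0 ∨ b ≤ r) then
        slideU fuel (upd (upd f i j b) (i+1) j 0) (i+1) j
      else
        slideU fuel (upd (upd f i j r) i (j+1) 0) i (j+1)

/-- One lower jeu de taquin slide: the pawn starts at `(i, j)` and repeatedly
exchanges with the larger of the letters to its left and above it (the one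
above in case of ties), until neither exists. -/
def slideL : ℕ → (ℕ → ℕ → ℕ) → ℕ → ℕ → (ℕ → ℕ → ℕ)
  | 0, f, _, _ => f
  | fuel+1, f, i, j =>
      let l := if j = 0 then 0 else f i (j-1)
      let u := if i = 0 then 0 else f (i-1) j
      if l = 0 ∧ u = 0 then f
      else if u ≠ 0 ∧ (l = 0 ∨ l ≤ u) then
        slideL fuel (upd (upd f i j u) (i-1) j 0) (i-1) j
      else
        slideL fuel (upd (upd f i j l) i (j-1) 0) i (j-1)

/-- Rectification of a skew tableau of shape `lam - rho`: repeatedly slide into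
the inner corner at the end of the lowest row with nonzero inner shape,
updating the shape along the way, until the inner shape is empty. -/
def rectify (B : ℕ) : ℕ → List ℕ → List ℕ → (ℕ → ℕ → ℕ) → (ℕ → ℕ → ℕ)
  | 0, _, _, f => f
  | fuel+1, lam, rho, f =>
      match ((List.range lam.length).filter (fun i => 0 < rho.getD i 0)).max? with
      | none => f
      | some i =>
          let s := slideU B f i (rho.getD i 0 - 1)
          rectify B fuel (lam.set s.2.1 s.2.2) (rho.set i (rho.getD i 0 - 1)) s.1

/-- The jeu de taquin rectification `jdt(T)` of a skew tableau of shape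
`lam - rho`. -/
def rect (lam rho : List ℕ) (f : ℕ → ℕ → ℕ) : ℕ → ℕ → ℕ :=
  rectify (lam.length + lam.headD 0 + 1) (rho.sum + 1) lam rho f

/-- The tableau function associated to a list of columns. -/
def colsToFn (cols : List (List ℕ)) : ℕ → ℕ → ℕ :=
  fun i j => (cols.getD j []).getD i 0


/- ## Polynomial / fermionic machinery -/

/-- The Gaussian binomial coefficient `[p+m choose m]_t` as a polynomial,
defined by the `q`-Pascal recurrence. -/
noncomputable def gauss : ℕ → ℕ → Polynomial ℤ
  | _, 0 => 1
  | 0, _ + 1 => 1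
  | p + 1, m + 1 => gauss p (m + 1) + Polynomial.X ^ (p + 1) * gauss (p + 1) m
  termination_by p m => p + m

/-- `n(μ) = Σ_i (i-1) μ_i`. -/
def nstat (mu : List ℕ) : ℕ := ∑ i ∈ Finset.range mu.length, i * mu.getD i 0

/-- `Q_i(λ) = Σ_j min(i, λ_j)`. -/
def Qi (i : ℕ) (l : List ℕ) : ℤ := ((l.map (fun x => min i x)).sum : ℤ)

/-- `Σ_{i,j} min(i,j) m_i(λ) m_j(κ)`, computed as `Σ_{x ∈ λ, y ∈ κ} min(x,y)`. -/
def pairMin (l k : List ℕ) : ℤ :=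
  ((l.map (fun x => (k.map (fun y => min x y)).sum)).sum : ℤ)

/-- Vacancy numbers `p_i^{(a)}` of a configuration `nu` (where `nu 0 = μ` is
the multiplicity data and `nu a = []` for `a ≥ n`). -/
def pVac (nu : ℕ → List ℕ) (a i : ℕ) : ℤ :=
  Qi i (nu (a-1)) - 2 * Qi i (nu a) + Qi i (nu (a+1))

/-- Admissible `L(μ)`-configurations of weight `lam` in type `A_{n-1}`. -/
def AdmConf (n : ℕ) (mu lam : List ℕ) : Set (ℕ → List ℕ) :=
  {nu | (∀ a, IsPartition (nu a)) ∧ nu 0 = mu ∧ (∀ a, n ≤ a → nu a = []) ∧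
    (∀ a, 1 ≤ a → a ≤ n - 1 → (nu a).sum = (lam.drop a).sum) ∧
    (∀ a i, 1 ≤ a → a ≤ n - 1 → 1 ≤ i → 0 ≤ pVac nu a i)}

/-- The cocharge `cc(ν) = ½ Σ_{a,b∈I₀} (α_a,α_b) Σ_{i,j} min(i,j) m_i^{(a)} m_j^{(b)}`
of a configuration, written without the factor `½` by collecting the diagonal
terms (`(α_a,α_a) = 2`) and the adjacent terms (`(α_a,α_{a±1}) = -1`). -/
def ccConf (n : ℕ) (nu : ℕ → List ℕ) : ℤ :=
  (∑ a ∈ Finset.Icc 1 (n-1), pairMin (nu a) (nu a)) -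
  (∑ a ∈ Finset.Icc 1 (n-2), pairMin (nu a) (nu (a+1)))

/-- The set of semistandard tableaux of straight shape `lam` and weight `mu`,
as functions. -/
def TabSet (lam mu : List ℕ) : Set (ℕ → ℕ → ℕ) :=
  {f | IsSkewFn lam [] f ∧ wtEq (readWordF lam.length (lam.headD 0) f) mu}

/-- The Kostka polynomial `K_{λ,μ}(t)`, via the Lascoux–Schützenberger charge
formula `K_{λ,μ}(t) = Σ_{T ∈ Tab(λ,μ)} t^{c(T)}`. -/
noncomputable def kostka (lam mu : List ℕ) : Polynomial ℤ :=
  ∑ᶠ f ∈ TabSet lam mu,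
    (Polynomial.X : Polynomial ℤ) ^ charge (readWordF lam.length (lam.headD 0) f)

/-- The Littlewood–Richardson coefficient `c^ν_{λ',λ''}`: the number of
semistandard skew tableaux of shape `ν - λ'` and weight `λ''` whose reading
word is a lattice permutation. -/
noncomputable def lrCoeff (l' l'' nu : List ℕ) : ℕ :=
  {f : ℕ → ℕ → ℕ | IsSkewFn nu l' f ∧
    IsLattice (readWordF nu.length (nu.headD 0) f) ∧
    wtEq (readWordF nu.length (nu.headD 0) f) l''}.ncard

/-- The fermionic formula `M(μ, λ; t)` of type `A_{n-1}`, as a Laurent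
polynomial: the sum over admissible configurations of
`t^{cc(ν)} Π_{(a,i)} [p_i^{(a)} + m_i^{(a)}, m_i^{(a)}]_t`. -/
noncomputable def fermionicM (n : ℕ) (mu lam : List ℕ) : LaurentPolynomial ℤ :=
  ∑ᶠ nu ∈ AdmConf n mu lam,
    LaurentPolynomial.T (ccConf n nu) *
      ∏ᶠ a ∈ Set.Icc 1 (n-1), ∏ᶠ i ∈ {i : ℕ | 1 ≤ i},
        Polynomial.toLaurent (gauss ((pVac nu a i).toNat) ((nu a).count i))

/- ## Rigged configurations (with riggings as multisets of strings) -/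

/-- `Q_i` for a multiset of parts. -/
def QiM (i : ℕ) (s : Multiset ℕ) : ℤ := ((s.map (fun x => min i x)).sum : ℤ)

/-- The underlying configuration of a rigged configuration: `ν^{(0)} = μ`, and
`ν^{(a)}` is the multiset of string lengths of `RC a` for `a ≥ 1`. -/
def nuOf (mu : List ℕ) (RC : ℕ → Multiset (ℕ × ℤ)) (a : ℕ) : Multiset ℕ :=
  if a = 0 then (mu : Multiset ℕ) else (RC a).map Prod.fst

/-- Vacancy numbers of a rigged configuration. -/
def pRC (mu : List ℕ) (RC : ℕ → Multiset (ℕ × ℤ)) (a i : ℕ) : ℤ :=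
  QiM i (nuOf mu RC (a-1)) - 2 * QiM i (nuOf mu RC a) + QiM i (nuOf mu RC (a+1))

/-- Basic validity of a rigged configuration in type `A_{n-1}`: nothing outside
`1 ≤ a ≤ n-1`, and all string lengths are positive. -/
def RCvalid (n : ℕ) (RC : ℕ → Multiset (ℕ × ℤ)) : Prop :=
  RC 0 = 0 ∧ (∀ a, n ≤ a → RC a = 0) ∧ ∀ a s, s ∈ RC a → 1 ≤ s.1

end DK

namespace DK

open Function

/-- The `i`-th letter of a column, with `⊤` in every empty box. -/
def entry (col : List ℕ) (i : ℕ) : WithTop ℕ := col[i]?.elim ⊤ WithTop.some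

/-- The letter of a tableau in column `j` and row `i`, with `⊤` in every empty box. -/
def tabEntry (T : List (List ℕ)) (j : ℕ) : ℕ → WithTop ℕ := entry (T.getD j [])

/-- Inserting `a` into the column `C` bumps `b` from row `p` and leaves the column `C'`.
Bumping `⊤` means ending in an empty box, and inserting `⊤` changes nothing. -/
structure Bump (a : WithTop ℕ) (C : ℕ → WithTop ℕ) (p : ℕ) (b : WithTop ℕ)
    (C' : ℕ → WithTop ℕ) : Prop where
  lt_of_lt : ∀ i < p, C i < a
  le : a ≤ C p
  out : b = C p
  new : C' = update C p a

/-- Inserting a letter into `S` produces `S'`: the letter `l j` enters column `j` in row `p j`,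
and the new box is in (1-indexed) row `r`. -/
structure BumpPath (S S' : ℕ → ℕ → WithTop ℕ) (l : ℕ → WithTop ℕ) (p : ℕ → ℕ) (r : ℕ) :
    Prop where
  bump : ∀ j, Bump (l j) (S j) (p j) (l (j + 1)) (S' j)
  final : ∃ J, l J ≠ ⊤ ∧ l (J + 1) = ⊤ ∧ r = p J + 1

/-- Semistandardness of a tableau whose empty boxes are filled with `⊤`. -/
structure IsTab (S : ℕ → ℕ → WithTop ℕ) : Prop where
  col : ∀ j i i', i < i' → S j i < S j i' ∨ S j i' = ⊤
  row : ∀ j i, S j i ≤ S (j + 1) i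

/-! ### Bumping in a single column -/

namespace Bump

variable {a b a' b' : WithTop ℕ} {C C' C'' : ℕ → WithTop ℕ} {p q : ℕ}

lemma new_self (h : Bump a C p b C') : C' p = a := by simp [h.new]

lemma new_of_ne (h : Bump a C p b C') {i : ℕ} (hi : i ≠ p) : C' i = C i := by
  simp [h.new, hi]

lemma le_out (h : Bump a C p b C') : a ≤ b := h.out ▸ h.le

lemma new_le (h : Bump a C p b C') (i : ℕ) : C' i ≤ C i := by
  rcases eq_or_ne i p with rfl | hi
  · exact h.new_self ▸ h.le
  · exact (h.new_of_ne hi).le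

lemma new_le_letter (h : Bump a C p b C') {i : ℕ} (hi : i ≤ p) : C' i ≤ a := by
  rcases hi.eq_or_lt with rfl | hi
  · exact h.new_self.le
  · exact h.new_of_ne hi.ne ▸ (h.lt_of_lt i hi).le

lemma row_le_of_le (h : Bump a C p b C') {i : ℕ} (hi : a ≤ C i) : p ≤ i :=
  not_lt.1 fun hlt => (h.lt_of_lt i hlt).not_ge hi

lemma col (h : Bump a C p b C') (hC : ∀ i i', i < i' → C i < C i' ∨ C i' = ⊤) (i i' : ℕ)
    (hi : i < i') : C' i < C' i' ∨ C' i' = ⊤ := by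
  rcases eq_or_ne i' p with rfl | hp
  · rw [h.new_self, h.new_of_ne hi.ne]
    exact .inl (h.lt_of_lt i hi)
  · rw [h.new_of_ne hp]
    exact (hC i i' hi).imp_left (h.new_le i).trans_lt

/-- A weakly smaller letter inserted next enters weakly above. -/
lemma row_anti (h : Bump a C p b C') (h' : Bump a' C' q b' C'') (ha : a' ≤ a) : q ≤ p :=
  h'.row_le_of_le (h.new_self ▸ ha)

/-- A weakly smaller letter inserted next bumps a letter that is at most the previous one. -/
lemma out_le (h : Bump a C p b C') (h' : Bump a' C' q b' C'') (ha : a' ≤ a) : b' ≤ a :=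
  h'.out ▸ h.new_le_letter (h.row_anti h' ha)

end Bump

lemma le_of_bumps {C : ℕ → ℕ → WithTop ℕ} {a b : ℕ → WithTop ℕ} {p : ℕ → ℕ} {t : ℕ}
    (h : ∀ k < t, Bump (a k) (C k) (p k) (b k) (C (k + 1))) {k m : ℕ} (hkm : k ≤ m)
    (hm : m ≤ t) (i : ℕ) : C m i ≤ C k i := by
  induction m, hkm using Nat.le_induction with
  | base => rfl
  | succ m _ ih => exact ((h m (by omega)).new_le i).trans (ih (by omega))

/-- If the letters inserted between the steps `k` and `m` are all larger than `z` or `⊤`, then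
boxes whose letter is larger than `z` or `⊤` keep this property. -/
lemma lt_or_top_of_bumps {C : ℕ → ℕ → WithTop ℕ} {a b : ℕ → WithTop ℕ} {p : ℕ → ℕ}
    {k m i : ℕ} {z : WithTop ℕ} (hkm : k ≤ m)
    (h : ∀ n, k ≤ n → n < m → Bump (a n) (C n) (p n) (b n) (C (n + 1)))
    (ha : ∀ n, k ≤ n → n < m → p n = i → z < a n ∨ a n = ⊤)
    (hz : z < C k i ∨ C k i = ⊤) : z < C m i ∨ C m i = ⊤ := by
  induction m, hkm using Nat.le_induction with
  | base => exact hz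
  | succ m hkm ih =>
    have hb := h m hkm (by omega)
    rcases eq_or_ne i (p m) with hi | hi
    · have := ha m hkm (by omega) hi.symm
      rwa [hi, hb.new_self]
    · rw [hb.new_of_ne hi]
      exact ih (fun n h₁ h₂ => h n h₁ (by omega)) fun n h₁ h₂ => ha n h₁ (by omega)

section DoubleRow

variable {C D : ℕ → ℕ → WithTop ℕ} {x x' y y' : ℕ → WithTop ℕ} {p q : ℕ → ℕ} {t : ℕ}

/-- If a double-row is inserted into a column, `y k` enters strictly below `x k`. -/
lemma row_lt_row_of_bumps
    (hC : ∀ k < t, Bump (x k) (C k) (p k) (x' k) (C (k + 1)))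
    (hD : ∀ k < t, Bump (y k) (D k) (q k) (y' k) (D (k + 1)))
    (hCD : D 0 = C t) {k : ℕ} (hk : k < t) (hxy : x k < y k) : p k < q k := by
  by_contra! hle
  have h₁ : D k (q k) ≤ D 0 (q k) := le_of_bumps hD (Nat.zero_le k) hk.le _
  have h₂ : C t (q k) ≤ C (k + 1) (q k) := le_of_bumps hC hk le_rfl _
  have h₃ := (hC k hk).new_le_letter hle
  rw [hCD] at h₁
  exact ((h₁.trans h₂).trans h₃).not_gt (hxy.trans_le (hD k hk).le)

/-- The letters bumped from a column by a double-row form a double-row. -/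
lemma out_lt_out_of_bumps
    (hC : ∀ k < t, Bump (x k) (C k) (p k) (x' k) (C (k + 1)))
    (hD : ∀ k < t, Bump (y k) (D k) (q k) (y' k) (D (k + 1)))
    (hCD : D 0 = C t)
    (hcol : ∀ k ≤ t, ∀ i i', i < i' → C k i < C k i' ∨ C k i' = ⊤)
    (hx : ∀ k m, k ≤ m → m < t → x m ≤ x k) (hy : ∀ k m, k ≤ m → m < t → y m ≤ y k)
    (hxy : ∀ k < t, x k < y k ∨ y k = ⊤) {k : ℕ} (hk : k < t) :
    x' k < y' k ∨ y' k = ⊤ := by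
  rcases hxy k hk with hlt | htop
  swap
  · exact .inr (top_le_iff.1 (htop ▸ (hD k hk).le_out))
  have hpq := row_lt_row_of_bumps hC hD hCD hk hlt
  have hrow : ∀ m, k ≤ m → m < t → p m ≤ p k := fun m hkm => by
    induction m, hkm using Nat.le_induction with
    | base => exact fun _ => le_rfl
    | succ m _ ih =>
      exact fun hm => ((hC m (by omega)).row_anti (hC (m + 1) hm) (hx m _ (by omega) hm)).trans
        (ih (by omega))
  have h₁ : x' k < C t (q k) ∨ C t (q k) = ⊤ := by
    refine lt_or_top_of_bumps hk.le (fun n _ hn => hC n hn) (fun n h₁ h₂ h₃ => ?_)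
      ((hC k hk).out ▸ hcol k hk.le _ _ hpq)
    have := hrow n h₁ h₂
    omega
  rw [(hD k hk).out]
  refine lt_or_top_of_bumps (Nat.zero_le k) (fun n _ hn => hD n (by omega))
    (fun n _ hn _ => ?_) (hCD ▸ h₁)
  obtain ⟨m, rfl⟩ : ∃ m, k = m + 1 := ⟨k - 1, by omega⟩
  have hout : x' (m + 1) ≤ x m :=
    (hC m (by omega)).out_le (hC (m + 1) hk) (hx m _ (by omega) hk)
  have hyn : y m ≤ y n := hy n m (by omega) (by omega)
  rcases hxy m (by omega) with h | h
  · exact .inl ((hout.trans_lt h).trans_le hyn)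
  · exact .inr (top_le_iff.1 (h ▸ hyn))

end DoubleRow

/-! ### Bumping paths in a tableau -/

namespace BumpPath

variable {S S' S'' : ℕ → ℕ → WithTop ℕ} {l l' : ℕ → WithTop ℕ} {p p' : ℕ → ℕ} {r r' : ℕ}

lemma monotone (h : BumpPath S S' l p r) : Monotone l :=
  monotone_nat_of_le_succ fun j => (h.bump j).le_out

lemma antitone_row (h : BumpPath S S' l p r) (hS : IsTab S) : Antitone p :=
  antitone_nat_of_succ_le fun j =>
    (h.bump (j + 1)).row_le_of_le ((h.bump j).out ▸ hS.row j (p j))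

lemma isTab (h : BumpPath S S' l p r) (hS : IsTab S) : IsTab S' where
  col j := (h.bump j).col (hS.col j)
  row j i := by
    rcases eq_or_ne i (p (j + 1)) with rfl | hi
    · rw [(h.bump (j + 1)).new_self]
      exact ((h.bump j).new_le_letter (h.antitone_row hS j.le_succ)).trans (h.bump j).le_out
    · rw [(h.bump (j + 1)).new_of_ne hi]
      exact ((h.bump j).new_le i).trans (hS.row j i)

lemma row_le_of_ne_top (h : BumpPath S S' l p r) (hS : IsTab S) {j : ℕ} (hj : l j ≠ ⊤) :
    r ≤ p j + 1 := by
  obtain ⟨J, -, hJ, rfl⟩ := h.final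
  have : j ≤ J := by
    by_contra! hlt
    exact hj (top_le_iff.1 (hJ ▸ h.monotone hlt))
  exact Nat.succ_le_succ (h.antitone_row hS this)

lemma le_of_le (h : BumpPath S S' l p r) (h' : BumpPath S' S'' l' p' r') (h₀ : l' 0 ≤ l 0)
    (j : ℕ) : l' j ≤ l j := by
  induction j with
  | zero => exact h₀
  | succ j ih => exact ((h.bump j).out_le (h'.bump j) ih).trans (h.bump j).le_out

/-- Inserting a weakly smaller letter next produces a new box weakly above. -/
lemma newRow_anti (h : BumpPath S S' l p r) (h' : BumpPath S' S'' l' p' r') (hS : IsTab S)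
    (h₀ : l' 0 ≤ l 0) : r' ≤ r := by
  obtain ⟨J, hJ, -, rfl⟩ := h.final
  have hle := h.le_of_le h' h₀ J
  exact (h'.row_le_of_ne_top (h.isTab hS) (ne_top_of_le_ne_top hJ hle)).trans
    (Nat.succ_le_succ ((h.bump J).row_anti (h'.bump J) hle))

end BumpPath

section Tableau

variable {S U : ℕ → ℕ → ℕ → WithTop ℕ} {x y : ℕ → ℕ → WithTop ℕ} {p q : ℕ → ℕ → ℕ}
  {r s : ℕ → ℕ} {t : ℕ}

lemma isTab_of_bumpPaths (h : ∀ k < t, BumpPath (S k) (S (k + 1)) (x k) (p k) (r k))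
    (hS : IsTab (S 0)) {k : ℕ} (hk : k ≤ t) : IsTab (S k) := by
  induction k with
  | zero => exact hS
  | succ k ih => exact (h k hk).isTab (ih (by omega))

lemma letters_anti (h : ∀ k < t, BumpPath (S k) (S (k + 1)) (x k) (p k) (r k))
    (hx : ∀ k, k + 1 < t → x (k + 1) 0 ≤ x k 0) (j k m : ℕ) (hkm : k ≤ m) (hm : m < t) :
    x m j ≤ x k j := by
  induction m, hkm using Nat.le_induction with
  | base => rfl
  | succ m _ ih =>
    exact ((h m (by omega)).le_of_le (h (m + 1) hm) (hx m hm) j).trans (ih (by omega))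

/-- If a double-row is inserted into a tableau, the new box of `y k` is strictly below that
of `x k`. -/
lemma newRow_lt_of_bumpPaths
    (hX : ∀ k < t, BumpPath (S k) (S (k + 1)) (x k) (p k) (r k))
    (hY : ∀ k < t, BumpPath (U k) (U (k + 1)) (y k) (q k) (s k))
    (hSU : U 0 = S t) (hS : IsTab (S 0))
    (hx : ∀ k, k + 1 < t → x (k + 1) 0 ≤ x k 0) (hy : ∀ k, k + 1 < t → y (k + 1) 0 ≤ y k 0)
    (hxy : ∀ k < t, x k 0 < y k 0) {k : ℕ} (hk : k < t) : r k < s k := by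
  have key : ∀ j, ∀ k < t, x k j < y k j ∨ y k j = ⊤ := fun j => by
    induction j with
    | zero => exact fun k hk => .inl (hxy k hk)
    | succ j ih =>
      exact fun k hk => out_lt_out_of_bumps (C := fun k => S k j) (D := fun k => U k j)
        (fun k hk => (hX k hk).bump j) (fun k hk => (hY k hk).bump j) (congrFun hSU j)
        (fun k hk => (isTab_of_bumpPaths hX hS hk).col j) (letters_anti hX hx j)
        (letters_anti hY hy j) ih hk
  obtain ⟨J, hJ, -, hs⟩ := (hY k hk).final
  have hlt := (key J k hk).resolve_right hJ
  have hr := (hX k hk).row_le_of_ne_top (isTab_of_bumpPaths hX hS hk.le) hlt.ne_top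
  have hpq := row_lt_row_of_bumps (C := fun k => S k J) (D := fun k => U k J)
    (fun k hk => (hX k hk).bump J) (fun k hk => (hY k hk).bump J) (congrFun hSU J) hk hlt
  omega

end Tableau

/-! ### Tableaux as lists of columns -/

@[simp] lemma entry_nil (i : ℕ) : entry [] i = ⊤ := rfl

@[simp] lemma entry_cons_zero (a : ℕ) (c : List ℕ) : entry (a :: c) 0 = a := rfl

@[simp] lemma entry_cons_succ (a : ℕ) (c : List ℕ) (i : ℕ) :
    entry (a :: c) (i + 1) = entry c i := rfl

lemma entry_of_lt {col : List ℕ} {i : ℕ} (hi : i < col.length) : entry col i = col[i] := by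
  simp [entry, hi]

lemma entry_of_le {c : List ℕ} {i : ℕ} (hi : c.length ≤ i) : entry c i = ⊤ := by
  simp [entry, hi]

lemma bump_insertCol (a : ℕ) (c : List ℕ) :
    ∃ p, Bump a (entry c) p ((insertCol a c).1.elim ⊤ WithTop.some) (entry (insertCol a c).2) ∧
      ((insertCol a c).1 = none → p = c.length) := by
  induction c with
  | nil =>
    refine ⟨0, ⟨by simp, by simp, rfl, ?_⟩, fun _ => rfl⟩
    ext1 i
    cases i <;> simp [insertCol]
  | cons z c ih =>
    by_cases haz : a ≤ z
    · refine ⟨0, ⟨by simp, by simpa using haz, by simp [insertCol, haz], ?_⟩,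
        by simp [insertCol, haz]⟩
      ext1 i
      cases i <;> simp [insertCol, haz]
    · obtain ⟨p, hp, hlen⟩ := ih
      refine ⟨p + 1, ⟨fun i hi => ?_, by simpa using hp.le, by simpa [insertCol, haz] using hp.out, ?_⟩,
        by simpa [insertCol, haz] using hlen⟩
      · cases i with
        | zero => simpa using haz
        | succ i => exact hp.lt_of_lt i (by omega)
      · ext1 i
        cases i with
        | zero => simp [insertCol, haz]
        | succ i => simp [insertCol, haz, hp.new, update_apply]

lemma bump_top (c : List ℕ) : Bump ⊤ (entry c) c.length ⊤ (entry c) where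
  lt_of_lt i hi := by simp [entry_of_lt hi]
  le := by simp [entry_of_le]
  out := by simp [entry_of_le]
  new := by
    rw [eq_comm, update_eq_self_iff]
    simp [entry_of_le]

lemma exists_bumpPath (a : ℕ) (T : List (List ℕ)) :
    ∃ (l : ℕ → WithTop ℕ) (p : ℕ → ℕ), l 0 = a ∧
      BumpPath (tabEntry T) (tabEntry (colInsert a T)) l p (newRow a T) := by
  induction T generalizing a with
  | nil =>
    refine ⟨fun j => j.casesOn a fun _ => ⊤, fun _ => 0, rfl, fun j => ?_, 0, by simp, rfl, rfl⟩
    cases j with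
    | zero =>
      obtain ⟨p, hp, hlen⟩ := bump_insertCol a []
      obtain rfl : p = 0 := hlen rfl
      exact hp
    | succ j => exact bump_top []
  | cons c T ih =>
    obtain ⟨p, hp, hlen⟩ := bump_insertCol a c
    rcases h : insertCol a c with ⟨_ | b, c'⟩
    · rw [h] at hp hlen
      obtain rfl := hlen rfl
      refine ⟨fun j => j.casesOn a fun _ => ⊤, fun j => ((c :: T).getD j []).length, rfl,
        fun j => ?_, 0, by simp, rfl, by simp [newRow, h]⟩
      cases j with
      | zero => simpa [tabEntry, colInsert, h] using hp
      | succ j => simpa [tabEntry, colInsert, h] using bump_top _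
    · rw [h] at hp
      obtain ⟨l, q, hl, hpath⟩ := ih b
      obtain ⟨J, hJ, hJ', hr⟩ := hpath.final
      refine ⟨fun j => j.casesOn a l, fun j => j.casesOn p q, rfl,
        fun j => ?_, J + 1, hJ, hJ', by simpa [newRow, h] using hr⟩
      cases j with
      | zero => simpa [tabEntry, colInsert, h, hl] using hp
      | succ j => simpa [tabEntry, colInsert, h] using hpath.bump j

lemma IsColTab.isTab {T : List (List ℕ)} (hT : IsColTab T) : IsTab (tabEntry T) where
  col j i i' hi := by
    rcases lt_or_ge i' (T.getD j []).length with hi' | hi'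
    swap
    · exact .inr (entry_of_le hi')
    left
    rw [tabEntry, entry_of_lt hi', entry_of_lt (hi.trans hi')]
    have hj : j < T.length := by
      by_contra! hj
      simp [hj] at hi'
    have hc : (T.getD j []).IsChain (· < ·) :=
      hT.colStrict _ (by rw [List.getD_eq_getElem _ _ hj]; exact List.getElem_mem hj)
    exact WithTop.coe_lt_coe.2 (List.pairwise_iff_getElem.1 hc.pairwise i i' _ hi' hi)
  row j i := by
    rcases lt_or_ge i (T.getD (j + 1) []).length with hi | hi
    swap
    · exact le_top.trans_eq (entry_of_le hi).symm
    have hj : j + 1 < T.length := by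
      by_contra! hj
      simp [hj] at hi
    have hlen : (T.getD (j + 1) []).length ≤ (T.getD j []).length := by
      have := List.isChain_iff_getElem.1 hT.lenDecr j (by simpa using hj)
      simpa [List.getD_eq_getElem, hj, Nat.lt_of_succ_lt hj] using this
    have := hT.rowWeak j i hi
    rw [List.getD_eq_getElem _ _ hi, List.getD_eq_getElem _ _ (hi.trans_le hlen)] at this
    rw [tabEntry, tabEntry, entry_of_lt hi, entry_of_lt (hi.trans_le hlen)]
    exact WithTop.coe_le_coe.2 this

end DK

/-- Proposition 1.2.4: inserting the double-row word
`y_t ⋯ y_1 x_t ⋯ x_1` into a tableau of partition shape produces new boxes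
whose row indices `R^y_t ⋯ R^y_1 R^x_t ⋯ R^x_1` again form a double-row. -/
theorem double_row_insert (t : ℕ) (x y : ℕ → ℕ) (T : List (List ℕ))
    (hT : DK.IsColTab T)
    (hpos : ∀ k, 1 ≤ k → k ≤ t → 0 < x k)
    (hx : ∀ k, 1 ≤ k → k < t → x (k + 1) ≤ x k)
    (hy : ∀ k, 1 ≤ k → k < t → y (k + 1) ≤ y k)
    (hxy : ∀ k, 1 ≤ k → k ≤ t → x k < y k) :
    (∀ k, 1 ≤ k → k < t →
      DK.newRow (x (k + 1)) (DK.insertUpTo x T k) ≤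
        DK.newRow (x k) (DK.insertUpTo x T (k - 1))) ∧
    (∀ k, 1 ≤ k → k < t →
      DK.newRow (y (k + 1)) (DK.insertUpTo y (DK.insertUpTo x T t) k) ≤
        DK.newRow (y k) (DK.insertUpTo y (DK.insertUpTo x T t) (k - 1))) ∧
    (∀ k, 1 ≤ k → k ≤ t →
      DK.newRow (x k) (DK.insertUpTo x T (k - 1)) <
        DK.newRow (y k) (DK.insertUpTo y (DK.insertUpTo x T t) (k - 1))) := by
  choose l p hl hX using fun k => DK.exists_bumpPath (x (k + 1)) (DK.insertUpTo x T k)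
  choose m q hm hY using fun k =>
    DK.exists_bumpPath (y (k + 1)) (DK.insertUpTo y (DK.insertUpTo x T t) k)
  have hX' : ∀ k < t, _ := fun k _ => hX k
  have hY' : ∀ k < t, _ := fun k _ => hY k
  have hS : DK.IsTab (DK.tabEntry (DK.insertUpTo x T 0)) := hT.isTab
  have hU := DK.isTab_of_bumpPaths (S := fun k => DK.tabEntry (DK.insertUpTo x T k)) hX' hS le_rfl
  have hx' : ∀ k, k + 1 < t → l (k + 1) 0 ≤ l k 0 := fun k hk => by
    simpa [hl] using hx (k + 1) (by omega) hk
  have hy' : ∀ k, k + 1 < t → m (k + 1) 0 ≤ m k 0 := fun k hk => by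
    simpa [hm] using hy (k + 1) (by omega) hk
  have hxy' : ∀ k < t, l k 0 < m k 0 := fun k hk => by
    simpa [hl, hm] using hxy (k + 1) (by omega) hk
  refine ⟨fun k hk hkt => ?_, fun k hk hkt => ?_, fun k hk hkt => ?_⟩ <;>
    obtain ⟨k, rfl⟩ : ∃ n, k = n + 1 := ⟨k - 1, by omega⟩
  · exact (hX k).newRow_anti (hX (k + 1))
      (DK.isTab_of_bumpPaths (S := fun k => DK.tabEntry (DK.insertUpTo x T k)) hX' hS
        (by omega)) (hx' k hkt)
  · exact (hY k).newRow_anti (hY (k + 1))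
      (DK.isTab_of_bumpPaths
        (S := fun k => DK.tabEntry (DK.insertUpTo y (DK.insertUpTo x T t) k)) hY' hU
        (by omega)) (hy' k hkt)
  · exact DK.newRow_lt_of_bumpPaths (S := fun k => DK.tabEntry (DK.insertUpTo x T k))
      (U := fun k => DK.tabEntry (DK.insertUpTo y (DK.insertUpTo x T t) k))
      hX' hY' rfl hS hx' hy' hxy' hkt
end

section
/- If $w$ and $w'$ are words of positive integers that are Knuth equivalent and whose weights are partitions, then they have the same charge: $c(w) = c(w')$. -/
namespace DK

open scoped List

/-- The largest excess of letters `r` over letters `r + 1` among the prefixes of a word. -/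
def excess (r : ℕ) : List ℕ → ℕ
  | [] => 0
  | a :: v => if a = r then excess r v + 1 else if a = r + 1 then excess r v - 1 else excess r v

theorem excess_append_mono (r : ℕ) (u : List ℕ) {v v' : List ℕ} (h : excess r v ≤ excess r v') :
    excess r (u ++ v) ≤ excess r (u ++ v') := by
  induction u with
  | nil => exact h
  | cons a u ih =>
    simp only [List.cons_append, excess]
    split_ifs <;> omega

theorem excess_le_of_prefix (r g : ℕ) (v : List ℕ)
    (h : ∀ p, p <+: v → p.count r ≤ p.count (r + 1) + g) : excess r v ≤ g := by
  induction v generalizing g with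
  | nil => simp [excess]
  | cons a v ih =>
    simp only [excess]
    split_ifs with h1 h2
    · have h0 := h [a] (by simp)
      simp [h1] at h0
      have := ih (g - 1) fun p hp => by
        have := h (a :: p) (by simpa using hp)
        simp [h1] at this
        omega
      omega
    · have := ih (g + 1) fun p hp => by
        have := h (a :: p) (by simpa using hp)
        simp [h2] at this
        omega
      omega
    · exact ih g fun p hp => by
        have := h (a :: p) (by simpa using hp)
        simpa [List.count_cons, h1, h2] using this

/-- `v` is dominated by `v'`: same content, and no excess of `v'` is larger. -/
def Dominates (v' v : List ℕ) : Prop := v'.Perm v ∧ ∀ r, excess r v' ≤ excess r v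

theorem Dominates.append_left (u : List ℕ) {v' v : List ℕ} (h : Dominates v' v) :
    Dominates (u ++ v') (u ++ v) :=
  ⟨h.1.append_left u, fun r => excess_append_mono r u (h.2 r)⟩

theorem dominates_swap {x z : ℕ} (v : List ℕ) (h : x < z) :
    Dominates (z :: x :: v) (x :: z :: v) := by
  refine ⟨List.Perm.swap _ _ _, fun r => ?_⟩
  simp only [excess]
  split_ifs <;> omega

theorem dominates_swap_of_far {x z : ℕ} (v : List ℕ) (h : x + 1 < z) :
    Dominates (x :: z :: v) (z :: x :: v) := by
  refine ⟨List.Perm.swap _ _ _, fun r => ?_⟩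
  simp only [excess]
  split_ifs <;> omega

theorem dominates_k1 {x y z : ℕ} (v : List ℕ) (hxy : x ≤ y) (hyz : y < z) :
    Dominates (x :: z :: y :: v) (z :: x :: y :: v) := by
  refine ⟨List.Perm.swap _ _ _, fun r => ?_⟩
  simp only [excess]
  split_ifs <;> omega

theorem dominates_k2 {x y z : ℕ} (v : List ℕ) (hxy : x < y) (hyz : y ≤ z) :
    Dominates (y :: x :: z :: v) (y :: z :: x :: v) := by
  refine ⟨(List.Perm.swap _ _ _).cons _, fun r => ?_⟩
  simp only [excess]
  split_ifs <;> omega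

theorem Dominates.rfl {v : List ℕ} : Dominates v v := ⟨.refl _, fun _ => le_rfl⟩

/-- Sublists of three letters followed by a word. -/
theorem sublist_three {a b c : ℕ} {v s : List ℕ} : s <+ a :: b :: c :: v ↔
    ∃ t, t <+ v ∧ (s = t ∨ s = a :: t ∨ s = b :: t ∨ s = c :: t ∨ s = a :: b :: t ∨
      s = a :: c :: t ∨ s = b :: c :: t ∨ s = a :: b :: c :: t) := by
  constructor
  · intro h
    simp only [List.sublist_cons_iff] at h
    grind
  · rintro ⟨t, ht, h⟩
    have hc := ht.cons c
    have hcc := ht.cons_cons c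
    rcases h with rfl | rfl | rfl | rfl | rfl | rfl | rfl | rfl
    exacts [(hc.cons b).cons a, (hc.cons b).cons_cons a, (hc.cons_cons b).cons a,
      (hcc.cons b).cons a, (hc.cons_cons b).cons_cons a, (hcc.cons b).cons_cons a,
      (hcc.cons_cons b).cons a, (hcc.cons_cons b).cons_cons a]

theorem exists_dominates_of_local {l l' : List ℕ}
    (h : ∀ v s, s <+ l ++ v → ∃ s', s' <+ l' ++ v ∧ Dominates s' s) (u v s : List ℕ)
    (hs : s <+ u ++ (l ++ v)) : ∃ s', s' <+ u ++ (l' ++ v) ∧ Dominates s' s := by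
  obtain ⟨s₁, s₂, rfl, h₁, h₂⟩ := List.sublist_append_iff.1 hs
  obtain ⟨s', hs', hd⟩ := h v s₂ h₂
  exact ⟨s₁ ++ s', h₁.append hs', hd.append_left s₁⟩

theorem exists_dominates_of_step {w w' : List ℕ} (h : KnuthStep w w' ∨ KnuthStep w' w)
    {s : List ℕ} (hs : s <+ w) : ∃ s', s' <+ w' ∧ Dominates s' s := by
  rcases h with h | h
  · cases h with
    | k1 u v x y z hxy hyz =>
      refine exists_dominates_of_local (l := [x, z, y]) (l' := [z, x, y]) ?_ u v s hs
      intro v s hs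
      obtain ⟨t, ht, h⟩ := sublist_three.1 hs
      rcases h with rfl | rfl | rfl | rfl | rfl | rfl | rfl | rfl
      case inr.inr.inr.inr.inl =>
        exact ⟨z :: x :: t, sublist_three.2 ⟨t, ht, by simp⟩, dominates_swap t (by omega)⟩
      case inr.inr.inr.inr.inr.inr.inr =>
        exact ⟨z :: x :: y :: t, sublist_three.2 ⟨t, ht, by simp⟩, dominates_swap _ (by omega)⟩
      all_goals exact ⟨_, sublist_three.2 ⟨_, ht, by simp⟩, Dominates.rfl⟩
    | k2 u v x y z hxy hyz =>
      refine exists_dominates_of_local (l := [y, z, x]) (l' := [y, x, z]) ?_ u v s hs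
      intro v s hs
      obtain ⟨t, ht, h⟩ := sublist_three.1 hs
      rcases h with rfl | rfl | rfl | rfl | rfl | rfl | rfl | rfl
      case inr.inr.inr.inr.inr.inr.inl =>
        rcases eq_or_ne z (x + 1) with hz | hz
        · obtain rfl : y = z := by omega
          exact ⟨y :: x :: t, sublist_three.2 ⟨t, ht, by simp⟩, Dominates.rfl⟩
        · exact ⟨x :: z :: t, sublist_three.2 ⟨t, ht, by simp⟩, dominates_swap_of_far t (by omega)⟩
      case inr.inr.inr.inr.inr.inr.inr =>
        exact ⟨y :: x :: z :: t, sublist_three.2 ⟨t, ht, by simp⟩, dominates_k2 _ hxy hyz⟩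
      all_goals exact ⟨_, sublist_three.2 ⟨_, ht, by simp⟩, Dominates.rfl⟩
  · cases h with
    | k1 u v x y z hxy hyz =>
      refine exists_dominates_of_local (l := [z, x, y]) (l' := [x, z, y]) ?_ u v s hs
      intro v s hs
      obtain ⟨t, ht, h⟩ := sublist_three.1 hs
      rcases h with rfl | rfl | rfl | rfl | rfl | rfl | rfl | rfl
      case inr.inr.inr.inr.inl =>
        rcases eq_or_ne z (x + 1) with hz | hz
        · obtain rfl : y = x := by omega
          exact ⟨z :: y :: t, sublist_three.2 ⟨t, ht, by simp⟩, Dominates.rfl⟩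
        · exact ⟨x :: z :: t, sublist_three.2 ⟨t, ht, by simp⟩, dominates_swap_of_far t (by omega)⟩
      case inr.inr.inr.inr.inr.inr.inr =>
        exact ⟨x :: z :: y :: t, sublist_three.2 ⟨t, ht, by simp⟩, dominates_k1 _ hxy hyz⟩
      all_goals exact ⟨_, sublist_three.2 ⟨_, ht, by simp⟩, Dominates.rfl⟩
    | k2 u v x y z hxy hyz =>
      refine exists_dominates_of_local (l := [y, x, z]) (l' := [y, z, x]) ?_ u v s hs
      intro v s hs
      obtain ⟨t, ht, h⟩ := sublist_three.1 hs
      rcases h with rfl | rfl | rfl | rfl | rfl | rfl | rfl | rfl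
      case inr.inr.inr.inr.inr.inr.inl =>
        exact ⟨z :: x :: t, sublist_three.2 ⟨t, ht, by simp⟩, dominates_swap t (by omega)⟩
      case inr.inr.inr.inr.inr.inr.inr =>
        exact ⟨y :: z :: x :: t, sublist_three.2 ⟨t, ht, by simp⟩,
          (dominates_swap t (by omega)).append_left [y]⟩
      all_goals exact ⟨_, sublist_three.2 ⟨_, ht, by simp⟩, Dominates.rfl⟩

/-- Counting functions of a sublist along the prefixes of the ambient word. -/
theorem exists_counting_of_sublist {v w : List ℕ} (h : v <+ w) :
    ∃ N : ℕ → ℕ → ℕ, (∀ r, N r 0 = 0) ∧ (∀ r, N r w.length = v.count r) ∧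
      (∀ r k, N r (k + 1) ≤ N r k + if w[k]? = some r then 1 else 0) ∧
      ∀ r k, N r k ≤ N (r + 1) k + excess r v := by
  induction h with
  | slnil => exact ⟨fun _ _ => 0, by simp [excess]⟩
  | @cons v w a h ih =>
    obtain ⟨N, h0, hn, hs, he⟩ := ih
    refine ⟨fun r k => N r (k - 1), by simpa using h0, by simpa using hn, ?_, fun r k => he r _⟩
    rintro r (_ | k)
    · simp
    · simpa using hs r k
  | @cons_cons v w a h ih =>
    obtain ⟨N, h0, hn, hs, he⟩ := ih
    refine ⟨fun r k => if k = 0 then 0 else N r (k - 1) + if a = r then 1 else 0, by simp, ?_, ?_, ?_⟩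
    · intro r
      simp [hn, List.count_cons]
    · rintro r (_ | k)
      · simp [h0]
      · have := hs r k
        simp at this ⊢
        omega
    · rintro r (_ | k)
      · simp
      · have := he r k
        simp only [excess]
        simp
        split_ifs <;> omega

theorem greedy_layer {n m : ℕ} {Q : ℕ → Prop} [DecidablePred Q] {a b : ℕ → ℕ} {f : ℕ → ℤ}
    (hb : ∀ j < m, Q (b j)) (hQn : ∀ q, Q q → q < n)
    (inj : ∀ i j, i < j → j < m → b i ≠ b j) (ha : ∀ j < m, ¬ Q (a j))
    (greedy : ∀ j < m, ∀ q, Q q → (∀ i < j, b i ≠ q) →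
      (b j < a j → ¬ (b j < q ∧ q < a j)) ∧ (a j < b j → a j < q ∧ q ≤ b j))
    (hstep : ∀ k, f (k + 1) ≤ f k + if Q k then 1 else 0)
    (hn : f n = f 0 + m)
    (hf : ∀ k ≤ n, (∑ j ∈ Finset.range m, if a j < k then (1 : ℤ) else 0) ≤ f k)
    (k : ℕ) (hk : k ≤ n) :
    (∑ j ∈ Finset.range m, if b j < k then (1 : ℤ) else 0) +
      (∑ j ∈ Finset.range m, if a j < b j then (1 : ℤ) else 0) ≤ f k := by
  rcases Nat.eq_zero_or_pos m with rfl | hm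
  · simpa using hf k hk
  have hbn : ∀ j < m, b j < n := fun j hj => hQn _ (hb j hj)
  set Nb : ℕ → ℤ := fun k => ∑ j ∈ Finset.range m, if b j < k then (1 : ℤ) else 0 with hNb
  set g : ℤ := ∑ j ∈ Finset.range m, if a j < b j then (1 : ℤ) else 0
  let free : ℕ → Prop := fun q => Q q ∧ ∀ i < m - 1, b i ≠ q
  have hfree : free (b (m - 1)) :=
    ⟨hb _ (by omega), fun i hi => inj i _ hi (by omega)⟩
  have cut : ∀ q, free q → Nb q + g = ∑ j ∈ Finset.range m, if a j < q then (1 : ℤ) else 0 := by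
    intro q hq
    rw [hNb, ← Finset.sum_add_distrib]
    refine Finset.sum_congr rfl fun j hj => ?_
    have hj : j < m := by simpa using hj
    have h1 := greedy j hj q hq.1 fun i hi => hq.2 i (by omega)
    have h2 : a j ≠ q := by rintro rfl; exact ha j hj hq.1
    have h3 : a j ≠ b j := fun e => ha j hj (e ▸ hb j hj)
    split_ifs <;> omega
  -- between two cuts with no free position, `Nb` grows at least as fast as `f`
  have grow : ∀ p q, p ≤ q → (∀ i, p ≤ i → i < q → ¬ free i) → f q - f p ≤ Nb q - Nb p := by
    intro p q hpq
    induction q, hpq using Nat.le_induction with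
    | base => simp
    | succ q hpq ih =>
      intro h
      have h1 := ih fun i h1 h2 => h i h1 (by omega)
      have h2 := hstep q
      have hmono : ∀ j ∈ Finset.range m,
          (if b j < q then (1 : ℤ) else 0) ≤ if b j < q + 1 then (1 : ℤ) else 0 := by
        intro j _; split_ifs <;> omega
      have h3 : Nb q + (if Q q then 1 else 0) ≤ Nb (q + 1) := by
        split_ifs with hQ
        · have h4 : ¬ free q := h q hpq (by omega)
          simp only [free, hQ, true_and] at h4
          push Not at h4
          obtain ⟨i, hi, rfl⟩ := h4
          exact Int.add_one_le_of_lt (Finset.sum_lt_sum hmono ⟨i, by simp; omega, by simp⟩)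
        · simpa only [add_zero] using Finset.sum_le_sum hmono
      omega
  have hN0 : Nb 0 = 0 := by simp [hNb]
  have hNn : Nb n = m := by
    simp only [hNb]
    rw [Finset.sum_congr rfl fun j hj => if_pos (hbn j (by simpa using hj))]
    simp
  classical
  by_cases hex : ∃ q, k ≤ q ∧ free q
  · obtain ⟨hkq, hq⟩ := Nat.find_spec hex
    have hmin : ∀ i, k ≤ i → i < Nat.find hex → ¬ free i :=
      fun i h1 h2 h3 => Nat.find_min hex h2 ⟨h1, h3⟩
    have h1 := grow k _ hkq hmin
    have h2 := cut _ hq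
    have hqn : Nat.find hex ≤ n := (hQn _ hq.1).le
    have h3 := hf _ hqn
    change Nb k + g ≤ f k
    omega
  · push Not at hex
    have hex' : ∃ q, free q := ⟨_, hfree⟩
    have hq := Nat.find_spec hex'
    have h1 := grow 0 _ (Nat.zero_le _) fun i _ h2 h3 => Nat.find_min hex' h2 h3
    have h2 := cut _ hq
    have h3 := hf _ ((Nat.find_min' hex' hfree).trans (hbn _ (by omega)).le)
    have h4 := grow k n hk fun i h1 _ => hex i h1
    change Nb k + g ≤ f k
    omega

theorem lt_length_of_getD {w : List ℕ} {q t : ℕ} (h : w.getD q 0 = t + 1) : q < w.length := by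
  by_contra! hq
  rw [List.getD_eq_default _ _ hq] at h
  omega

theorem mem_iff_getD {w : List ℕ} {t : ℕ} : t + 1 ∈ w ↔ ∃ q, w.getD q 0 = t + 1 := by
  constructor
  · intro h
    obtain ⟨q, hq, e⟩ := List.getElem_of_mem h
    exact ⟨q, by rw [List.getD_eq_getElem _ _ hq, e]⟩
  · rintro ⟨q, h⟩
    have hq := lt_length_of_getD h
    rw [List.getD_eq_getElem _ _ hq] at h
    exact h ▸ List.getElem_mem hq

/-- `b` is the first element of `Q` met when moving cyclically leftwards from `a`. -/
def IsNextLeft (Q : ℕ → Prop) (a b : ℕ) : Prop :=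
  ∀ q, Q q → (b < a → ¬ (b < q ∧ q < a)) ∧ (a < b → a < q ∧ q ≤ b)

theorem chooseNext_spec {w : List ℕ} {start t p : ℕ} (h : chooseNext w start (t + 1) = some p)
    (hs : w.getD start 0 ≠ t + 1) :
    w.getD p 0 = t + 1 ∧ IsNextLeft (fun q => w.getD q 0 = t + 1) start p := by
  unfold chooseNext at h
  simp only at h
  have key : ∀ q, w.getD q 0 = t + 1 → q < w.length ∧ q ≠ start :=
    fun q hq => ⟨lt_length_of_getD hq, fun e => hs (e ▸ hq)⟩
  rcases h1 : (((List.range w.length).filter (fun p => w.getD p 0 = t + 1)).filter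
    (fun p => p < start)).max? with _ | p₁
  · rw [h1] at h
    replace h : (((List.range w.length).filter (fun p => w.getD p 0 = t + 1)).filter
      (fun p => start < p)).max? = some p := h
    rw [List.max?_eq_some_iff] at h
    rw [List.max?_eq_none_iff, List.filter_eq_nil_iff] at h1
    simp only [List.mem_filter, List.mem_range, decide_eq_true_eq] at h h1
    refine ⟨h.1.1.2, fun q hq => ⟨fun hlt => by omega, fun _ => ?_⟩⟩
    have h2 := h1 q ⟨(key q hq).1, hq⟩
    have h3 : start < q := by have := (key q hq).2; omega
    exact ⟨h3, h.2 q ⟨⟨(key q hq).1, hq⟩, h3⟩⟩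
  · rw [h1] at h
    obtain rfl : p₁ = p := by simpa using h
    rw [List.max?_eq_some_iff] at h1
    simp only [List.mem_filter, List.mem_range, decide_eq_true_eq] at h1
    refine ⟨h1.1.1.2, fun q hq => ⟨fun _ hq' => ?_, fun hlt => by omega⟩⟩
    have := h1.2 q ⟨⟨(key q hq).1, hq⟩, hq'.2⟩
    omega

theorem chooseNext_none {w : List ℕ} {start t : ℕ} (h : chooseNext w start (t + 1) = none)
    (hs : w.getD start 0 ≠ t + 1) : t + 1 ∉ w := by
  intro hmem
  obtain ⟨q, hq⟩ := mem_iff_getD.1 hmem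
  have hl := lt_length_of_getD hq
  have hne : q ≠ start := fun e => hs (e ▸ hq)
  unfold chooseNext at h
  simp only at h
  rcases h1 : (((List.range w.length).filter (fun p => w.getD p 0 = t + 1)).filter
    (fun p => p < start)).max? with _ | p₁
  · rw [h1] at h
    replace h : (((List.range w.length).filter (fun p => w.getD p 0 = t + 1)).filter
      (fun p => start < p)).max? = none := h
    rw [List.max?_eq_none_iff, List.filter_eq_nil_iff] at h h1
    simp only [List.mem_filter, List.mem_range, decide_eq_true_eq] at h h1
    have h2 := h q ⟨hl, hq⟩
    have h3 := h1 q ⟨hl, hq⟩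
    omega
  · rw [h1] at h
    exact absurd h (by simp)

theorem extractAux_spec {w : List ℕ} {L : ℕ} (hL : ∀ t, t + 1 ∈ w ↔ t < L) (fuel start t : ℕ)
    (hs : w.getD start 0 = t) (ht : t ≤ L) (hf : L ≤ t + fuel) :
    (extractAux w fuel start (t + 1)).length = L - t ∧ ∀ i < L - t,
      w.getD ((extractAux w fuel start (t + 1)).getD i 0) 0 = t + i + 1 ∧
      IsNextLeft (fun q => w.getD q 0 = t + i + 1)
        ((start :: extractAux w fuel start (t + 1)).getD i 0)
        ((start :: extractAux w fuel start (t + 1)).getD (i + 1) 0) := by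
  induction fuel generalizing start t with
  | zero =>
    obtain rfl : L = t := by omega
    simp [extractAux]
  | succ fuel ih =>
    rcases h : chooseNext w start (t + 1) with _ | p
    · have := mt (hL t).2 (chooseNext_none h (by omega))
      obtain rfl : L = t := by omega
      simp [extractAux, h]
    · obtain ⟨h1, h2⟩ := chooseNext_spec h (by omega)
      have h3 := (hL t).1 (mem_iff_getD.2 ⟨p, h1⟩)
      obtain ⟨h4, h5⟩ := ih p (t + 1) h1 h3 (by omega)
      simp only [extractAux, h]
      refine ⟨by simp [h4]; omega, ?_⟩
      rintro (_ | i) hi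
      · exact ⟨by simpa using h1, by simpa using h2⟩
      · have := h5 i (by omega)
        rw [show t + (i + 1) + 1 = t + 1 + i + 1 by omega]
        simpa only [List.getD_cons_succ] using this

/-- Successive greedy paths through the word `w`, the `j`-th path visiting the positions
`P j 1, P j 2, …` of the letters `1, 2, …`, starting from the right end `P j 0` of the word. -/
structure IsGreedyFamily (w : List ℕ) (P : ℕ → ℕ → ℕ) : Prop where
  start : ∀ j, P j 0 = w.length
  letter : ∀ t j, j < w.count (t + 1) → w.getD (P j (t + 1)) 0 = t + 1
  inj : ∀ t i j, i < j → j < w.count (t + 1) → P i (t + 1) ≠ P j (t + 1)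
  greedy : ∀ t j, j < w.count (t + 1) →
    IsNextLeft (fun q => w.getD q 0 = t + 1 ∧ ∀ i < j, P i (t + 1) ≠ q) (P j t) (P j (t + 1))

/-- The number of transitions at which a path jumps from the left end to the right end of the
word before reaching the letter `R + 1`. -/
def wraps (p : ℕ → ℕ) (R : ℕ) : ℕ :=
  ∑ i ∈ Finset.range (R + 1), if p i < p (i + 1) then 1 else 0

theorem wraps_succ (p : ℕ → ℕ) (R : ℕ) :
    wraps p (R + 1) = wraps (fun i => p (i + 1)) R + if p 0 < p 1 then 1 else 0 :=
  Finset.sum_range_succ' _ _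

theorem sum_wraps_succ (p : ℕ → ℕ) (n : ℕ) :
    ∑ R ∈ Finset.range (n + 1), wraps p R =
      ∑ R ∈ Finset.range n, wraps (fun i => p (i + 1)) R + (n + 1) * if p 0 < p 1 then 1 else 0 := by
  rw [Finset.sum_range_succ', Finset.sum_congr rfl fun R _ => wraps_succ p R,
    Finset.sum_add_distrib]
  have h0 : wraps p 0 = if p 0 < p 1 then 1 else 0 := Finset.sum_range_one _
  rw [h0]
  simp only [Finset.sum_const, Finset.card_range, smul_eq_mul]
  ring

theorem chargeIdxAux_add_wraps (idx prev : ℕ) (ps : List ℕ)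
    (h : ∀ i < ps.length, (prev :: ps).getD i 0 ≠ (prev :: ps).getD (i + 1) 0) :
    chargeIdxAux idx prev ps +
      ∑ R ∈ Finset.range ps.length, wraps (fun i => (prev :: ps).getD i 0) R =
      ∑ R ∈ Finset.range ps.length, (R + 1 + idx) := by
  induction ps generalizing idx prev with
  | nil => simp [chargeIdxAux]
  | cons p ps ih =>
    have h0 := h 0 (by simp)
    have ih := ih (if p < prev then idx + 1 else idx) p fun i hi => by
      simpa only [List.getD_cons_succ] using h (i + 1) (by simpa using hi)
    rw [List.length_cons, sum_wraps_succ, Finset.sum_range_succ']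
    simp only [List.getD_cons_zero, List.getD_cons_succ, chargeIdxAux, zero_add] at ih h0 ⊢
    have hsum : ∑ R ∈ Finset.range ps.length, (R + 1 + 1 + idx) =
        ∑ R ∈ Finset.range ps.length, (R + 1 + idx) + ps.length := by
      rw [Finset.sum_congr rfl fun R _ => show R + 1 + 1 + idx = (R + 1 + idx) + 1 by ring,
        Finset.sum_add_distrib]
      simp
    have hsum' : ∑ R ∈ Finset.range ps.length, (R + 1 + (idx + 1)) =
        ∑ R ∈ Finset.range ps.length, (R + 1 + idx) + ps.length := by
      rw [← hsum]
      exact Finset.sum_congr rfl fun R _ => by ring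
    split_ifs at ih ⊢ <;> omega

theorem chargePos_add_wraps {n : ℕ} (ps : List ℕ) (hn : ∀ p ∈ ps, p < n)
    (h : ∀ i < ps.length, (n :: ps).getD i 0 ≠ (n :: ps).getD (i + 1) 0) :
    chargePos ps + ∑ R ∈ Finset.range ps.length, wraps (fun i => (n :: ps).getD i 0) R =
      ∑ R ∈ Finset.range ps.length, R := by
  cases ps with
  | nil => simp [chargePos]
  | cons p ps =>
    have hp := hn p (by simp)
    have := chargeIdxAux_add_wraps 0 p ps fun i hi => by
      simpa only [List.getD_cons_succ] using h (i + 1) (by simpa using hi)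
    rw [List.length_cons, sum_wraps_succ, Finset.sum_range_succ']
    simp only [List.getD_cons_zero, List.getD_cons_succ, chargePos, add_zero] at this ⊢
    rw [if_neg (by omega)]
    omega

theorem count_map_filter_range (U : ℕ → Prop) [DecidablePred U] (f : ℕ → ℕ) (n r : ℕ) :
    (((List.range n).filter U).map f).count r =
      ((Finset.range n).filter (fun p => U p ∧ f p = r)).card := by
  induction n with
  | zero => simp
  | succ n ih =>
    rw [List.range_succ, List.filter_append, List.map_append, List.count_append, ih,
      Finset.range_add_one, Finset.filter_insert]
    by_cases hU : U n <;> by_cases hf : f n = r <;> simp [hU, hf]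

theorem map_getD_range (w : List ℕ) : (List.range w.length).map (fun p => w.getD p 0) = w := by
  refine List.ext_getElem (by simp) fun i h1 h2 => ?_
  rw [List.getElem_map, List.getElem_range, List.getD_eq_getElem _ _ h2]

theorem count_eq_card (w : List ℕ) (r : ℕ) :
    w.count r = ((Finset.range w.length).filter (fun p => w.getD p 0 = r)).card := by
  have := count_map_filter_range (fun _ => True) (fun p => w.getD p 0) w.length r
  simpa only [decide_true, List.filter_true, map_getD_range, true_and] using this

theorem le_length_of_forall_mem {w : List ℕ} {k : ℕ} (h : ∀ t < k, t + 1 ∈ w) : k ≤ w.length := by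
  calc k = ((Finset.range k).image (· + 1)).card := by
        rw [Finset.card_image_of_injective _ (add_left_injective 1), Finset.card_range]
    _ ≤ w.toFinset.card := Finset.card_le_card fun x hx => by
        obtain ⟨t, ht, rfl⟩ := Finset.mem_image.1 hx
        exact List.mem_toFinset.2 (h t (Finset.mem_range.1 ht))
    _ ≤ w.length := w.toFinset_card_le

theorem HasPartitionWeight.antitone_count {w : List ℕ} (h : HasPartitionWeight w) :
    Antitone fun t => w.count (t + 1) :=
  antitone_nat_of_succ_le fun t => h.2 (t + 1) (by omega)

theorem HasPartitionWeight.exists_height {w : List ℕ} (h : HasPartitionWeight w) :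
    ∃ L ≤ w.length, ∀ t, t + 1 ∈ w ↔ t < L := by
  have hex : ∃ t, t + 1 ∉ w := by
    by_contra! hall
    have := le_length_of_forall_mem (k := w.length + 1) fun t _ => hall t
    omega
  refine ⟨Nat.find hex, le_length_of_forall_mem fun t ht => not_not.1 (Nat.find_min hex ht),
    fun t => ⟨fun ht => ?_, fun ht => not_not.1 (Nat.find_min hex ht)⟩⟩
  by_contra! hle
  have h0 := List.count_eq_zero.2 (Nat.find_spec hex)
  have h1 : w.count (t + 1) ≤ w.count (Nat.find hex + 1) := h.antitone_count hle
  have h2 := List.count_pos_iff.2 ht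
  omega

/-- The positions below `n` which are not in `ps`, in increasing order. -/
def remaining (n : ℕ) (ps : List ℕ) : List ℕ := (List.range n).filter (fun p => p ∉ ps)

theorem mem_remaining {n q : ℕ} {ps : List ℕ} : q ∈ remaining n ps ↔ q < n ∧ q ∉ ps := by
  simp [remaining]

theorem remaining_getD_lt {n p p' : ℕ} {ps : List ℕ} (hp : p < p')
    (hp' : p' ≤ (remaining n ps).length) :
    (remaining n ps).getD p n < (remaining n ps).getD p' n := by
  rw [List.getD_eq_getElem _ _ (by omega)]
  rcases hp'.eq_or_lt with rfl | hlt
  · rw [List.getD_eq_default _ _ le_rfl]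
    exact (mem_remaining.1 (List.getElem_mem _)).1
  · rw [List.getD_eq_getElem _ _ hlt]
    exact List.pairwise_iff_getElem.1 (List.pairwise_lt_range.filter _) _ _ _ _ hp

theorem remaining_getD_lt_iff {n p p' : ℕ} {ps : List ℕ} (hp : p ≤ (remaining n ps).length)
    (hp' : p' ≤ (remaining n ps).length) :
    (remaining n ps).getD p n < (remaining n ps).getD p' n ↔ p < p' := by
  refine ⟨fun h => ?_, fun h => remaining_getD_lt h hp'⟩
  rcases lt_trichotomy p p' with h1 | rfl | h1
  · exact h1
  · omega
  · have := remaining_getD_lt h1 hp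
    omega

theorem length_removePositions (w ps : List ℕ) :
    (removePositions w ps).length = (remaining w.length ps).length :=
  List.length_map _

theorem removePositions_getD (w ps : List ℕ) (p : ℕ) :
    (removePositions w ps).getD p 0 = w.getD ((remaining w.length ps).getD p w.length) 0 := by
  rcases lt_or_ge p (remaining w.length ps).length with h | h
  · rw [List.getD_eq_getElem _ _ (by rwa [length_removePositions]), List.getD_eq_getElem _ _ h]
    exact List.getElem_map _
  · rw [List.getD_eq_default _ _ (by rwa [length_removePositions]), List.getD_eq_default _ _ h,
      List.getD_eq_default _ _ le_rfl]

theorem removePositions_sublist (w ps : List ℕ) : removePositions w ps <+ w := by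
  have := (List.filter_sublist (p := fun p => decide (p ∉ ps)) (l := List.range w.length)).map
    (fun p => w.getD p 0)
  rwa [map_getD_range] at this

section extract

variable {w ps : List ℕ} {L : ℕ}

/-- The list `ps` consists of positions of the letters `1, 2, …, L` of `w`. -/
def IsPath (w ps : List ℕ) (L : ℕ) : Prop :=
  ps.length = L ∧ ∀ t < L, w.getD (ps.getD t 0) 0 = t + 1

theorem IsPath.getD_mem (h : IsPath w ps L) {t : ℕ} (ht : t < L) : ps.getD t 0 ∈ ps := by
  rw [List.getD_eq_getElem _ _ (h.1 ▸ ht)]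
  exact List.getElem_mem _

theorem IsPath.eq_getD (h : IsPath w ps L) {q t : ℕ} (hq : q ∈ ps) (ht : w.getD q 0 = t + 1) :
    t < L ∧ ps.getD t 0 = q := by
  obtain ⟨s, hs, rfl⟩ := List.getElem_of_mem hq
  rw [← List.getD_eq_getElem _ 0 hs] at ht ⊢
  rw [h.1] at hs
  have := h.2 s hs
  obtain rfl : s = t := by omega
  exact ⟨hs, rfl⟩

theorem IsPath.count_removePositions (h : IsPath w ps L) (hL : ∀ t, t + 1 ∈ w ↔ t < L) (t : ℕ) :
    (removePositions w ps).count (t + 1) + (if t < L then 1 else 0) = w.count (t + 1) := by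
  split_ifs with ht
  · unfold removePositions
    rw [count_map_filter_range, count_eq_card,
      ← Finset.card_insert_of_notMem (a := ps.getD t 0)]
    · congr 1
      ext q
      simp only [Finset.mem_insert, Finset.mem_filter, Finset.mem_range]
      constructor
      · rintro (rfl | hq)
        · exact ⟨lt_length_of_getD (h.2 t ht), h.2 t ht⟩
        · exact ⟨hq.1, hq.2.2⟩
      · rintro ⟨hq, hq'⟩
        by_cases hps : q ∈ ps
        · exact Or.inl (h.eq_getD hps hq').2.symm
        · exact Or.inr ⟨hq, hps, hq'⟩
    · simp only [Finset.mem_filter, not_and]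
      exact fun _ hn => absurd (h.getD_mem ht) hn
  · have h0 := List.count_eq_zero.2 (mt (hL t).1 ht)
    have := (removePositions_sublist w ps).count_le (t + 1)
    omega

theorem IsPath.hasPartitionWeight (h : IsPath w ps L) (hL : ∀ t, t + 1 ∈ w ↔ t < L)
    (hw : HasPartitionWeight w) : HasPartitionWeight (removePositions w ps) := by
  refine ⟨fun x hx => hw.1 x ((removePositions_sublist w ps).subset hx), fun i hi => ?_⟩
  obtain ⟨t, rfl⟩ : ∃ t, i = t + 1 := ⟨i - 1, by omega⟩
  have h0 := h.count_removePositions hL t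
  have h1 := h.count_removePositions hL (t + 1)
  have h2 := hw.2 _ hi
  have h3 : ¬ t + 1 < L → w.count (t + 1 + 1) = 0 := fun h' =>
    List.count_eq_zero.2 (mt (hL (t + 1)).1 h')
  split_ifs at h0 h1 <;> omega

/-- The path `ps` followed by the paths of a family in the remaining word. -/
def consPath (w ps : List ℕ) (P : ℕ → ℕ → ℕ) : ℕ → ℕ → ℕ
  | 0, i => (w.length :: ps).getD i 0
  | j + 1, i => (remaining w.length ps).getD (P j i) w.length

theorem IsGreedyFamily.lt_length {P : ℕ → ℕ → ℕ} (hP : IsGreedyFamily w P) {t j : ℕ}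
    (hj : j < w.count (t + 1)) : P j (t + 1) < w.length :=
  lt_length_of_getD (hP.letter t j hj)

theorem IsGreedyFamily.le_length {P : ℕ → ℕ → ℕ} (hP : IsGreedyFamily w P)
    (hw : HasPartitionWeight w) {t j i : ℕ} (hj : j < w.count (t + 1)) (hi : i ≤ t + 1) :
    P j i ≤ w.length := by
  cases i with
  | zero => exact (hP.start j).le
  | succ i => exact (hP.lt_length (hj.trans_le (hw.antitone_count (by omega)))).le

theorem IsGreedyFamily.cons {P : ℕ → ℕ → ℕ} (hP : IsGreedyFamily (removePositions w ps) P)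
    (h : IsPath w ps L) (hL : ∀ t, t + 1 ∈ w ↔ t < L) (hw : HasPartitionWeight w)
    (hgreedy : ∀ t < L, IsNextLeft (fun q => w.getD q 0 = t + 1) ((w.length :: ps).getD t 0)
      ((w.length :: ps).getD (t + 1) 0)) : IsGreedyFamily w (consPath w ps P) := by
  have hw' := h.hasPartitionWeight hL hw
  have hcount : ∀ t j, j + 1 < w.count (t + 1) → j < (removePositions w ps).count (t + 1) := by
    intro t j hj
    have := h.count_removePositions hL t
    split_ifs at this <;> omega
  have hpos : ∀ t j, j < w.count (t + 1) → t < L := fun t j hj =>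
    (hL t).1 (List.count_pos_iff.1 (by omega))
  constructor
  · rintro (_ | j)
    · rfl
    · simp only [consPath, hP.start, length_removePositions]
      exact List.getD_eq_default _ _ le_rfl
  · rintro t (_ | j) hj
    · simpa only [consPath, List.getD_cons_succ] using h.2 t (hpos t 0 hj)
    · simp only [consPath]
      rw [← removePositions_getD]
      exact hP.letter t j (hcount t j hj)
  · rintro t i (_ | j) hij hj
    · omega
    · have hlt := hP.lt_length (hcount t j hj)
      rw [length_removePositions] at hlt
      rcases i with _ | i
      · simp only [consPath, List.getD_cons_succ]
        intro heq
        have h1 := h.getD_mem (hpos t _ hj)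
        rw [heq, List.getD_eq_getElem _ _ hlt] at h1
        exact (mem_remaining.1 (List.getElem_mem hlt)).2 h1
      · have hlt' := hP.lt_length (hcount t i (by omega))
        rw [length_removePositions] at hlt'
        have hne := hP.inj t i j (by omega) (hcount t j hj)
        simp only [consPath]
        have h1 := remaining_getD_lt_iff hlt.le hlt'.le
        have h2 := remaining_getD_lt_iff hlt'.le hlt.le
        omega
  · rintro t (_ | j) hj q ⟨hq, hqn⟩
    · exact hgreedy t (hpos t 0 hj) q hq
    · have hmem : q ∈ remaining w.length ps := by
        refine mem_remaining.2 ⟨lt_length_of_getD hq, fun hps => ?_⟩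
        have := hqn 0 (by omega)
        simp only [consPath, List.getD_cons_succ] at this
        exact this (h.eq_getD hps hq).2
      obtain ⟨q', hq', rfl⟩ := List.getElem_of_mem hmem
      rw [← List.getD_eq_getElem _ w.length hq'] at hq hqn ⊢
      rw [← removePositions_getD] at hq
      have hb := hP.le_length hw' (hcount t j hj) le_rfl
      have ha := hP.le_length hw' (hcount t j hj) (Nat.le_succ t)
      rw [length_removePositions] at ha hb
      have := hP.greedy t j (hcount t j hj) q' ⟨hq, fun i hi heq =>
        hqn (i + 1) (by omega) (by simp only [consPath, heq])⟩
      simp only [consPath]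
      rw [remaining_getD_lt_iff ha hb, remaining_getD_lt_iff hb ha,
        remaining_getD_lt_iff hb hq'.le, remaining_getD_lt_iff hq'.le ha,
        remaining_getD_lt_iff ha hq'.le, ← not_lt, remaining_getD_lt_iff hb hq'.le, not_lt]
      exact this

theorem IsGreedyFamily.wraps_consPath {P : ℕ → ℕ → ℕ}
    (hP : IsGreedyFamily (removePositions w ps) P)
    (hw' : HasPartitionWeight (removePositions w ps)) {R j : ℕ}
    (hj : j < (removePositions w ps).count (R + 1)) :
    wraps (consPath w ps P (j + 1)) R = wraps (P j) R := by
  refine Finset.sum_congr rfl fun i hi => ?_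
  rw [Finset.mem_range] at hi
  have ha := hP.le_length hw' hj (i := i) (by omega)
  have hb := hP.le_length hw' hj (i := i + 1) (by omega)
  rw [length_removePositions] at ha hb
  simp only [consPath, remaining_getD_lt_iff ha hb]

end extract

theorem sum_range_ite_lt {L M : ℕ} (h : L ≤ M) (f : ℕ → ℕ) :
    (∑ R ∈ Finset.range M, if R < L then f R else 0) = ∑ R ∈ Finset.range L, f R := by
  rw [← Finset.sum_filter]
  refine Finset.sum_congr ?_ fun _ _ => rfl
  ext R
  simp only [Finset.mem_filter, Finset.mem_range]
  omega

theorem exists_greedyFamily (M fuel : ℕ) (w : List ℕ) (hf : w.length ≤ fuel) (hM : w.length ≤ M)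
    (hw : HasPartitionWeight w) : ∃ P, IsGreedyFamily w P ∧
      chargeFuel fuel w +
        ∑ R ∈ Finset.range M, ∑ j ∈ Finset.range (w.count (R + 1)), wraps (P j) R =
      ∑ R ∈ Finset.range M, w.count (R + 1) * R := by
  induction fuel generalizing w with
  | zero =>
    obtain rfl := List.length_eq_zero_iff.1 (Nat.le_zero.1 hf)
    exact ⟨fun _ _ => 0, ⟨by simp, by simp, by simp, by simp⟩, by simp [chargeFuel]⟩
  | succ fuel ih =>
    rcases eq_or_ne w [] with rfl | hne
    · exact ⟨fun _ _ => 0, ⟨by simp, by simp, by simp, by simp⟩, by simp [chargeFuel]⟩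
    obtain ⟨L, hLw, hL⟩ := hw.exists_height
    obtain ⟨hlen, hspec⟩ := extractAux_spec hL w.length w.length 0
      (List.getD_eq_default _ _ le_rfl) (Nat.zero_le _) (by omega)
    change (extract w).length = L - 0 at hlen
    change ∀ i < L - 0, w.getD ((extract w).getD i 0) 0 = 0 + i + 1 ∧
      IsNextLeft (fun q => w.getD q 0 = 0 + i + 1) ((w.length :: extract w).getD i 0)
        ((w.length :: extract w).getD (i + 1) 0) at hspec
    simp only [Nat.sub_zero, zero_add] at hlen hspec
    have hpath : IsPath w (extract w) L := ⟨hlen, fun t ht => (hspec t ht).1⟩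
    have hw' := hpath.hasPartitionWeight hL hw
    have hcount := hpath.count_removePositions hL
    have hL0 : 0 < L := by
      obtain ⟨x, hx⟩ := List.exists_mem_of_ne_nil _ hne
      have := hw.1 x hx
      have := (hL (x - 1)).1 (by rwa [Nat.sub_add_cancel this])
      omega
    have hlt : (removePositions w (extract w)).length < w.length := by
      refine lt_of_le_of_ne (removePositions_sublist _ _).length_le fun he => ?_
      have h0 := hcount 0
      rw [(removePositions_sublist _ _).eq_of_length he, if_pos hL0] at h0
      omega
    obtain ⟨P, hP, hsum⟩ := ih (removePositions w (extract w)) (by omega) (by omega) hw'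
    refine ⟨consPath w (extract w) P, hP.cons hpath hL hw fun t ht => (hspec t ht).2, ?_⟩
    have hmem : ∀ p ∈ extract w, p < w.length := by
      intro p hp
      obtain ⟨i, hi, rfl⟩ := List.getElem_of_mem hp
      rw [← List.getD_eq_getElem _ 0]
      exact lt_length_of_getD (hpath.2 i (hlen ▸ hi))
    have hcharge := chargePos_add_wraps (extract w) hmem fun i hi => by
      have h1 := hpath.2 i (hlen ▸ hi)
      cases i with
      | zero =>
        simp only [List.getD_cons_zero, List.getD_cons_succ]
        exact (lt_length_of_getD h1).ne'
      | succ i =>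
        have h2 := hpath.2 i (by omega)
        simp only [List.getD_cons_succ]
        intro he
        rw [he] at h2
        omega
    rw [hlen, ← sum_range_ite_lt (hLw.trans hM), ← sum_range_ite_lt (hLw.trans hM)] at hcharge
    have hwraps : ∑ R ∈ Finset.range M, ∑ j ∈ Finset.range (w.count (R + 1)),
          wraps (consPath w (extract w) P j) R =
        (∑ R ∈ Finset.range M, if R < L then
          wraps (fun i => (w.length :: extract w).getD i 0) R else 0) +
        ∑ R ∈ Finset.range M, ∑ j ∈ Finset.range ((removePositions w (extract w)).count (R + 1)),
          wraps (P j) R := by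
      rw [← Finset.sum_add_distrib]
      refine Finset.sum_congr rfl fun R _ => ?_
      rw [← hcount R]
      split_ifs with hR
      · rw [Finset.sum_range_succ', add_comm]
        congr 1
        exact Finset.sum_congr rfl fun j hj =>
          hP.wraps_consPath hw' (Finset.mem_range.1 hj)
      · have h0 := List.count_eq_zero.2 (mt (hL R).1 hR)
        rw [← hcount R, if_neg hR, add_zero] at h0
        simp [h0]
    have hweight : ∑ R ∈ Finset.range M, w.count (R + 1) * R =
        (∑ R ∈ Finset.range M, if R < L then R else 0) +
        ∑ R ∈ Finset.range M, (removePositions w (extract w)).count (R + 1) * R := by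
      rw [← Finset.sum_add_distrib]
      refine Finset.sum_congr rfl fun R _ => ?_
      rw [← hcount R]
      split_ifs <;> ring
    have hdef : chargeFuel (fuel + 1) w =
        chargePos (extract w) + chargeFuel fuel (removePositions w (extract w)) := by
      simp [chargeFuel, hne]
    rw [hdef, hwraps, hweight]
    omega

theorem getElem?_eq_some_iff_getD {w : List ℕ} {k t : ℕ} :
    w[k]? = some (t + 1) ↔ w.getD k 0 = t + 1 := by
  rw [List.getD_eq_getElem?_getD]
  cases w[k]? <;> simp

theorem IsGreedyFamily.sum_wraps_le {w v : List ℕ} {P : ℕ → ℕ → ℕ} (hP : IsGreedyFamily w P)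
    (hw : HasPartitionWeight w) {R : ℕ} (hv : v <+ w)
    (hm : ∀ i ≤ R, v.count (i + 1) = w.count (R + 1)) :
    ∑ j ∈ Finset.range (w.count (R + 1)), wraps (P j) R ≤
      ∑ i ∈ Finset.range R, excess (i + 1) v := by
  obtain ⟨N, hN0, hNn, hNstep, hNle⟩ := exists_counting_of_sublist hv
  set m := w.count (R + 1) with hmdef
  have hmt : ∀ t ≤ R, m ≤ w.count (t + 1) := fun t ht => hw.antitone_count ht
  let g : ℕ → ℤ := fun i => ∑ j ∈ Finset.range m, if P j i < P j (i + 1) then (1 : ℤ) else 0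
  let F : ℕ → ℕ → ℤ := fun t k => if t = 0 then 0 else
    (N t k : ℤ) + ∑ s ∈ Finset.range (t - 1), (excess (s + 1) v : ℤ)
  have hF : ∀ t k, F t k ≤ F (t + 1) k := by
    intro t k
    rcases t with _ | t
    · simp [F]
    · have := hNle (t + 1) k
      simp only [F, Nat.succ_ne_zero, if_false, Nat.add_sub_cancel, Finset.sum_range_succ]
      omega
  have key : ∀ t ≤ R + 1, ∀ k ≤ w.length,
      (∑ j ∈ Finset.range m, if P j t < k then (1 : ℤ) else 0) + ∑ i ∈ Finset.range t, g i ≤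
        F t k := by
    intro t
    induction t with
    | zero =>
      intro _ k hk
      simp [F, hP.start, hk.not_gt]
    | succ t ih =>
      intro ht k hk
      have hcount := hmt t (by omega)
      have := greedy_layer (n := w.length) (m := m) (Q := fun q => w.getD q 0 = t + 1)
        (a := fun j => P j t) (b := fun j => P j (t + 1))
        (f := fun k => F (t + 1) k - ∑ i ∈ Finset.range t, g i)
        (fun j hj => hP.letter t j (by omega)) (fun q hq => lt_length_of_getD hq)
        (fun i j hij hj => hP.inj t i j hij (by omega))
        (by
          intro j hj
          rcases t with _ | t
          · rw [hP.start, List.getD_eq_default _ _ le_rfl]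
            omega
          · rw [hP.letter t j (hj.trans_le (hmt t (by omega)))]
            omega)
        (fun j hj q hq hq' => hP.greedy t j (by omega) q ⟨hq, hq'⟩)
        (by
          intro k
          have := hNstep (t + 1) k
          simp only [getElem?_eq_some_iff_getD] at this
          simp only [F, Nat.succ_ne_zero, if_false]
          split_ifs at this ⊢ <;> omega)
        (by
          simp only [F, Nat.succ_ne_zero, if_false, hN0, hNn, hm t (by omega)]
          push_cast
          ring)
        (by
          intro k hk
          have h1 := ih (by omega) k hk
          have h2 := hF t k
          linarith)
        k hk
      rw [Finset.sum_range_succ]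
      change _ + (_ + ∑ j ∈ Finset.range m, if P j t < P j (t + 1) then (1 : ℤ) else 0) ≤ _
      linarith
  have h0 := key (R + 1) le_rfl 0 (Nat.zero_le _)
  simp only [Nat.not_lt_zero, if_false, Finset.sum_const_zero, zero_add, F, Nat.succ_ne_zero,
    hN0, Nat.add_sub_cancel, Nat.cast_zero] at h0
  have h1 : (∑ i ∈ Finset.range (R + 1), g i) =
      ((∑ j ∈ Finset.range m, wraps (P j) R : ℕ) : ℤ) := by
    simp only [g]
    rw [Finset.sum_comm]
    push_cast [wraps]
    rfl
  rw [h1] at h0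
  exact_mod_cast h0

theorem IsGreedyFamily.exists_sublist {w : List ℕ} {P : ℕ → ℕ → ℕ} (hP : IsGreedyFamily w P)
    (hw : HasPartitionWeight w) (R : ℕ) : ∃ v, v <+ w ∧
      (∀ i ≤ R, v.count (i + 1) = w.count (R + 1)) ∧
      ∑ i ∈ Finset.range R, excess (i + 1) v ≤
        ∑ j ∈ Finset.range (w.count (R + 1)), wraps (P j) R := by
  classical
  set m := w.count (R + 1) with hmdef
  have hmt : ∀ t ≤ R, m ≤ w.count (t + 1) := fun t ht => hw.antitone_count ht
  let U : ℕ → Prop := fun p => ∃ j < m, ∃ i ≤ R, P j (i + 1) = p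
  have hcount : ∀ k, ∀ i ≤ R, (((List.range k).filter U).map fun p => w.getD p 0).count (i + 1) =
      ∑ j ∈ Finset.range m, if P j (i + 1) < k then 1 else 0 := by
    intro k i hi
    rw [count_map_filter_range, ← Finset.card_filter,
      ← Finset.card_image_of_injOn (s := (Finset.range m).filter fun j => P j (i + 1) < k)
        (f := fun j => P j (i + 1))]
    · congr 1
      ext p
      simp only [Finset.mem_filter, Finset.mem_range, Finset.mem_image]
      constructor
      · rintro ⟨hpk, ⟨j, hj, i', hi', rfl⟩, hp⟩
        rw [hP.letter i' j (hj.trans_le (hmt i' hi'))] at hp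
        obtain rfl : i' = i := by omega
        exact ⟨j, ⟨hj, hpk⟩, rfl⟩
      · rintro ⟨j, ⟨hj, hpk⟩, rfl⟩
        exact ⟨hpk, ⟨j, hj, i, hi, rfl⟩, hP.letter i j (hj.trans_le (hmt i hi))⟩
    · intro j hj j' hj' he
      simp only [Finset.coe_filter, Finset.mem_range, Set.mem_ofPred_eq] at hj hj'
      by_contra hne
      have := hmt i hi
      rcases Nat.lt_or_gt_of_ne hne with h | h
      · exact hP.inj i j j' h (by omega) he
      · exact hP.inj i j' j h (by omega) he.symm
  refine ⟨((List.range w.length).filter U).map fun p => w.getD p 0, ?_, fun i hi => ?_, ?_⟩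
  · have := (List.filter_sublist (p := fun p => decide (U p)) (l := List.range w.length)).map
      (fun p => w.getD p 0)
    rwa [map_getD_range] at this
  · rw [hcount _ i hi, Finset.sum_congr rfl fun j hj =>
      if_pos (hP.lt_length ((Finset.mem_range.1 hj).trans_le (hmt i hi)))]
    simp
  · calc _ ≤ ∑ i ∈ Finset.range R, ∑ j ∈ Finset.range m,
          (if P j (i + 1) < P j (i + 1 + 1) then 1 else 0) := by
          refine Finset.sum_le_sum fun i hi => excess_le_of_prefix _ _ _ fun p hp => ?_
          have hi := Finset.mem_range.1 hi
          obtain ⟨p₁, hp₁, rfl⟩ := List.prefix_map_iff.1 hp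
          obtain ⟨p₂, hp₂, rfl⟩ := List.prefix_filter_iff.1 hp₁
          rw [List.prefix_iff_eq_take, List.take_range] at hp₂
          rw [hp₂, hcount _ i (by omega), hcount _ (i + 1) (by omega), ← Finset.sum_add_distrib]
          refine Finset.sum_le_sum fun j _ => ?_
          split_ifs <;> omega
      _ = ∑ j ∈ Finset.range m, ∑ i ∈ Finset.range R,
          (if P j (i + 1) < P j (i + 1 + 1) then 1 else 0) := Finset.sum_comm
      _ ≤ _ := Finset.sum_le_sum fun j _ => by
          rw [wraps, Finset.sum_range_succ']
          exact Nat.le_add_right _ _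

theorem KnuthStep.perm {w w' : List ℕ} (h : KnuthStep w w') : w.Perm w' := by
  cases h with
  | k1 u v x y z => exact (List.Perm.swap z x _).append_left u
  | k2 u v x y z => exact ((List.Perm.swap x z v).cons y).append_left u

theorem HasPartitionWeight.perm {w w' : List ℕ} (h : w.Perm w') (hw : HasPartitionWeight w) :
    HasPartitionWeight w' :=
  ⟨fun x hx => hw.1 x (h.mem_iff.2 hx), fun i hi => by
    rw [← h.count_eq, ← h.count_eq]; exact hw.2 i hi⟩

theorem IsGreedyFamily.sum_wraps_le_of_step {w w' : List ℕ} {P P' : ℕ → ℕ → ℕ}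
    (hP : IsGreedyFamily w P) (hP' : IsGreedyFamily w' P')
    (h : KnuthStep w w' ∨ KnuthStep w' w) (hw : HasPartitionWeight w) (R : ℕ) :
    ∑ j ∈ Finset.range (w'.count (R + 1)), wraps (P' j) R ≤
      ∑ j ∈ Finset.range (w.count (R + 1)), wraps (P j) R := by
  have hperm : w.Perm w' := h.elim KnuthStep.perm fun h => h.perm.symm
  obtain ⟨v, hv, hcount, hle⟩ := hP.exists_sublist hw R
  obtain ⟨v', hv', hvv, hex⟩ := exists_dominates_of_step h hv
  calc _ ≤ ∑ i ∈ Finset.range R, excess (i + 1) v' :=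
        hP'.sum_wraps_le (hw.perm hperm) hv' fun i hi => by
          rw [hvv.count_eq, hcount i hi, hperm.count_eq]
    _ ≤ ∑ i ∈ Finset.range R, excess (i + 1) v := Finset.sum_le_sum fun i _ => hex _
    _ ≤ _ := hle

theorem charge_eq_of_step {w w' : List ℕ} (h : KnuthStep w w') (hw : HasPartitionWeight w) :
    charge w = charge w' := by
  have hw' := hw.perm h.perm
  obtain ⟨P, hP, hc⟩ := exists_greedyFamily w.length w.length w le_rfl le_rfl hw
  obtain ⟨P', hP', hc'⟩ :=
    exists_greedyFamily w.length w'.length w' le_rfl h.perm.length_eq.ge hw'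
  have hG := Finset.sum_congr (rfl : Finset.range w.length = _) fun R _ =>
    le_antisymm (hP'.sum_wraps_le_of_step hP (Or.inr h) hw' R)
      (hP.sum_wraps_le_of_step hP' (Or.inl h) hw R)
  simp only [← h.perm.count_eq] at hc' hG
  unfold charge
  omega

theorem KnuthEquiv.perm_and_charge_eq {w w' : List ℕ} (h : KnuthEquiv w w') :
    w.Perm w' ∧ (HasPartitionWeight w → charge w = charge w') := by
  induction h with
  | rel x y h => exact ⟨h.perm, charge_eq_of_step h⟩
  | refl x => exact ⟨.refl x, fun _ => rfl⟩
  | symm x y _ ih => exact ⟨ih.1.symm, fun hy => (ih.2 (hy.perm ih.1.symm)).symm⟩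
  | trans x y z _ _ ih₁ ih₂ =>
    exact ⟨ih₁.1.trans ih₂.1, fun hx => (ih₁.2 hx).trans (ih₂.2 (hx.perm ih₁.1))⟩

end DK

/-- Lemma 1.3.1: Knuth equivalent words of partition weight have the same
charge. -/
theorem charge_knuth_invariant (w w' : List ℕ)
    (h : DK.KnuthEquiv w w')
    (hw : DK.HasPartitionWeight w) (hw' : DK.HasPartitionWeight w') :
    DK.charge w = DK.charge w' := by
  exact h.perm_and_charge_eq.2 hw
end

section
/- For any skew semistandard tableau $T$, the rectification of $T$ via jeu de taquin equals the tableau obtained by column-inserting the reading word of $T$ into the empty tableau: $\mathrm{jdt}(T) = [w(T) \to \emptyset]$. -/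
namespace DK

/- ## Passing a word through a column -/

/-- Insert the letters of a word successively into a single column, returning the new column
together with the word of bumped letters. -/
def passCol : List ℕ → List ℕ → List ℕ × List ℕ
  | [], c => (c, [])
  | a :: w, c =>
      ((passCol w (insertCol a c).2).1, (insertCol a c).1.toList ++ (passCol w (insertCol a c).2).2)

theorem insertList_cons (w c : List ℕ) (cs : List (List ℕ)) :
    insertList w (c :: cs) = (passCol w c).1 :: insertList (passCol w c).2 cs := by
  induction w generalizing c cs with
  | nil => simp [insertList, passCol]
  | cons a w ih =>
    rcases h : insertCol a c with ⟨_ | b, c'⟩ <;>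
      simp [insertList, passCol, colInsert, h, ih]

theorem insertList_append (w v : List ℕ) (T : List (List ℕ)) :
    insertList (w ++ v) T = insertList v (insertList w T) := by
  induction w generalizing T with
  | nil => rfl
  | cons a w ih => simp [insertList, ih]

theorem insertList_nil_eq (a : ℕ) (w : List ℕ) :
    insertList (a :: w) [] = (passCol (a :: w) []).1 :: insertList (passCol (a :: w) []).2 [] := by
  rw [← insertList_cons]
  simp [insertList, colInsert, insertCol]

theorem passCol_append (w v c : List ℕ) :
    passCol (w ++ v) c =
      ((passCol v (passCol w c).1).1, (passCol w c).2 ++ (passCol v (passCol w c).1).2) := by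
  induction w generalizing c with
  | nil => simp [passCol]
  | cons a w ih => simp [passCol, ih]

theorem mem_insertCol {a x : ℕ} {c : List ℕ} (h : x ∈ (insertCol a c).2) : x = a ∨ x ∈ c := by
  induction c with
  | nil => simpa [insertCol] using h
  | cons e es ih =>
    by_cases hae : a ≤ e
    · simp [insertCol, hae] at h ⊢; tauto
    · simp [insertCol, hae] at h ⊢
      rcases h with h | h
      · tauto
      · have := ih h; tauto

theorem insertCol_strict {a : ℕ} {c : List ℕ} (hc : c.Pairwise (· < ·)) :
    (insertCol a c).2.Pairwise (· < ·) := by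
  induction c with
  | nil => simp [insertCol]
  | cons e es ih =>
    rw [List.pairwise_cons] at hc
    by_cases hae : a ≤ e
    · simp only [insertCol, hae, if_true, List.pairwise_cons]
      exact ⟨fun x hx => lt_of_le_of_lt hae (hc.1 x hx), hc.2⟩
    · simp only [insertCol, hae, if_false, List.pairwise_cons]
      refine ⟨fun x hx => ?_, ih hc.2⟩
      rcases mem_insertCol hx with rfl | hx
      · omega
      · exact hc.1 x hx

theorem insertCol_bumped {a b : ℕ} {c : List ℕ} (h : (insertCol a c).1 = some b) :
    b ∈ c ∧ a ≤ b := by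
  induction c with
  | nil => simp [insertCol] at h
  | cons e es ih =>
    by_cases hae : a ≤ e
    · simp [insertCol, hae] at h; subst h; simp [hae]
    · simp [insertCol, hae] at h
      have := ih h
      simp [this.1, this.2]

theorem insertCol_bumped_of_le {y z : ℕ} (hyz : y ≤ z) (c : List ℕ) :
    ∃ b, (insertCol y (insertCol z c).2).1 = some b ∧ b ≤ z := by
  induction c with
  | nil => simp [insertCol, hyz]
  | cons e es ih =>
    by_cases hze : z ≤ e
    · simp [insertCol, hze, hyz]
    · by_cases hye : y ≤ e
      · simp [insertCol, hze, hye]; omega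
      · simpa [insertCol, hze, hye] using ih

theorem insertCol_bumped_of_lt {y z b : ℕ} (hyz : y < z) {c : List ℕ} (hc : c.Pairwise (· < ·))
    (h : (insertCol z (insertCol y c).2).1 = some b) :
    ∃ d, (insertCol y c).1 = some d ∧ d < b := by
  induction c with
  | nil => simp [insertCol, not_le.2 hyz] at h
  | cons e es ih =>
    rw [List.pairwise_cons] at hc
    by_cases hye : y ≤ e
    · simp [insertCol, hye, not_le.2 hyz] at h ⊢
      exact hc.1 b (insertCol_bumped h).1
    · have hze : ¬ z ≤ e := by omega
      simp [insertCol, hye, hze] at h ⊢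
      exact ih hc.2 h

/- ## Knuth relations in insertion order -/

/-- The elementary Knuth relations on three letters, for words whose letters are inserted
from the head of the list on. -/
inductive KnuthTriple : List ℕ → List ℕ → Prop
  | left (x y z : ℕ) (hxy : x < y) (hyz : y ≤ z) : KnuthTriple [x, z, y] [z, x, y]
  | right (x y z : ℕ) (hxy : x ≤ y) (hyz : y < z) : KnuthTriple [y, z, x] [y, x, z]

theorem passCol_left {x y z : ℕ} (hxy : x < y) (hyz : y ≤ z) {c : List ℕ}
    (hc : c.Pairwise (· < ·)) :
    (passCol [x, z, y] c).1 = (passCol [z, x, y] c).1 ∧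
      ((passCol [x, z, y] c).2 = (passCol [z, x, y] c).2 ∨
        KnuthTriple (passCol [x, z, y] c).2 (passCol [z, x, y] c).2) := by
  have hyx : ¬ y ≤ x := by omega
  have hzx : ¬ z ≤ x := by omega
  induction c with
  | nil => simp [passCol, insertCol, hyx, hzx, hyz, show x ≤ z by omega]
  | cons e es ih =>
    rw [List.pairwise_cons] at hc
    by_cases hxe : x ≤ e
    · by_cases hze : z ≤ e
      · rcases es with _ | ⟨h, es⟩
        · simp [passCol, insertCol, hyx, hzx, hyz, hxe, hze, show x ≤ z by omega]
        · have heh : e < h := hc.1 h (by simp)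
          simp [passCol, insertCol, hyx, hzx, hyz, hxe, hze, show x ≤ z by omega,
            show z ≤ h by omega, show y ≤ h by omega]
          exact Or.inr (KnuthTriple.right z e h hze heh)
      · obtain ⟨b, hb, hbz⟩ := insertCol_bumped_of_le hyz es
        rcases hz : (insertCol z es).1 with _ | d
        · simp [passCol, insertCol, hyx, hzx, hxe, hze, hz]
        · have hd := insertCol_bumped hz
          have heb : e < b := by
            rcases mem_insertCol (insertCol_bumped hb).1 with rfl | h
            · omega
            · exact hc.1 b h
          simp [passCol, insertCol, hyx, hzx, hxe, hze, hz, hb]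
          exact Or.inr (KnuthTriple.left e b d heb (by omega))
    · have := ih hc.2
      simpa [passCol, insertCol, hxe, show ¬ y ≤ e by omega, show ¬ z ≤ e by omega] using this

theorem passCol_right {x y z : ℕ} (hxy : x ≤ y) (hyz : y < z) {c : List ℕ}
    (hc : c.Pairwise (· < ·)) :
    (passCol [y, z, x] c).1 = (passCol [y, x, z] c).1 ∧
      ((passCol [y, z, x] c).2 = (passCol [y, x, z] c).2 ∨
        KnuthTriple (passCol [y, z, x] c).2 (passCol [y, x, z] c).2) := by
  have hzy : ¬ z ≤ y := by omega
  have hzx : ¬ z ≤ x := by omega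
  induction c with
  | nil => simp [passCol, insertCol, hzy, hzx, hxy]
  | cons e es ih =>
    rw [List.pairwise_cons] at hc
    by_cases hxe : x ≤ e
    · by_cases hye : y ≤ e
      · rcases hz : (insertCol z es).1 with _ | d
        · simp [passCol, insertCol, hzy, hzx, hxy, hye, hz]
        · simp [passCol, insertCol, hzy, hzx, hxy, hye, hz]
          exact Or.inr (KnuthTriple.right y e d hye (hc.1 d (insertCol_bumped hz).1))
      · have hze : ¬ z ≤ e := by omega
        rcases hz : (insertCol z (insertCol y es).2).1 with _ | d
        · simp [passCol, insertCol, hzx, hxe, hye, hze, hz]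
        · obtain ⟨b, hb, hbd⟩ := insertCol_bumped_of_lt hyz hc.2 hz
          have heb := hc.1 b (insertCol_bumped hb).1
          simp [passCol, insertCol, hzx, hxe, hye, hze, hz, hb]
          exact Or.inr (KnuthTriple.right e b d heb.le hbd)
    · have := ih hc.2
      simpa [passCol, insertCol, hxe, show ¬ y ≤ e by omega, show ¬ z ≤ e by omega] using this

/-- All columns are strictly increasing. -/
def ColsStrict (T : List (List ℕ)) : Prop := ∀ c ∈ T, c.Pairwise (· < ·)

theorem ColsStrict.colInsert {T : List (List ℕ)} (hT : ColsStrict T) (a : ℕ) :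
    ColsStrict (colInsert a T) := by
  induction T generalizing a with
  | nil => simp [ColsStrict, DK.colInsert]
  | cons c cs ih =>
    have hc : c.Pairwise (· < ·) := hT c (by simp)
    have hcs : ColsStrict cs := fun d hd => hT d (by simp [hd])
    have hc' := insertCol_strict (a := a) hc
    rcases h : insertCol a c with ⟨_ | b, c'⟩
    · rw [h] at hc'
      simp only [DK.colInsert, h]
      intro d hd
      rcases List.mem_cons.1 hd with rfl | hd
      · exact hc'
      · exact hcs d hd
    · rw [h] at hc'
      simp only [DK.colInsert, h]
      intro d hd
      rcases List.mem_cons.1 hd with rfl | hd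
      · exact hc'
      · exact ih hcs b d hd

theorem ColsStrict.insertList {T : List (List ℕ)} (hT : ColsStrict T) (w : List ℕ) :
    ColsStrict (insertList w T) := by
  induction w generalizing T with
  | nil => exact hT
  | cons a w ih => exact ih (hT.colInsert a)

theorem KnuthTriple.insertList_eq {w v : List ℕ} (h : KnuthTriple w v) {T : List (List ℕ)}
    (hT : ColsStrict T) : insertList w T = insertList v T := by
  induction T generalizing w v with
  | nil =>
    cases h with
    | left x y z hxy hyz =>
      simp [insertList, colInsert, insertCol, hyz, show ¬ y ≤ x by omega, show ¬ z ≤ x by omega,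
        show x ≤ z by omega]
    | right x y z hxy hyz =>
      simp [insertList, colInsert, insertCol, hxy, show ¬ z ≤ y by omega, show ¬ z ≤ x by omega]
  | cons c cs ih =>
    have hc : c.Pairwise (· < ·) := hT c (by simp)
    have hcs : ColsStrict cs := fun d hd => hT d (by simp [hd])
    rw [insertList_cons, insertList_cons]
    have key : (passCol w c).1 = (passCol v c).1 ∧
        ((passCol w c).2 = (passCol v c).2 ∨ KnuthTriple (passCol w c).2 (passCol v c).2) := by
      cases h with
      | left x y z hxy hyz => exact passCol_left hxy hyz hc
      | right x y z hxy hyz => exact passCol_right hxy hyz hc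
    rw [key.1]
    rcases key.2 with h2 | h2
    · rw [h2]
    · rw [ih h2 hcs]

/-- Two words insert to the same result into every tableau. -/
def InsEq (w v : List ℕ) : Prop := ∀ T, ColsStrict T → insertList w T = insertList v T

theorem InsEq.refl (w : List ℕ) : InsEq w w := fun _ _ => rfl

theorem InsEq.symm {w v : List ℕ} (h : InsEq w v) : InsEq v w := fun T hT => (h T hT).symm

theorem InsEq.trans {w v u : List ℕ} (h : InsEq w v) (h' : InsEq v u) : InsEq w u :=
  fun T hT => (h T hT).trans (h' T hT)

theorem InsEq.append_left {w v : List ℕ} (h : InsEq w v) (p : List ℕ) :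
    InsEq (p ++ w) (p ++ v) := fun T hT => by
  rw [insertList_append, insertList_append, h _ (hT.insertList p)]

theorem InsEq.append_right {w v : List ℕ} (h : InsEq w v) (s : List ℕ) :
    InsEq (w ++ s) (v ++ s) := fun T hT => by
  rw [insertList_append, insertList_append, h _ hT]

theorem InsEq.cons {w v : List ℕ} (h : InsEq w v) (a : ℕ) : InsEq (a :: w) (a :: v) :=
  h.append_left [a]

theorem KnuthTriple.insEq {w v : List ℕ} (h : KnuthTriple w v) : InsEq w v :=
  fun _ hT => h.insertList_eq hT

/-- A letter exceeding a weakly decreasing word can be moved left to its second position. -/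
theorem insEq_move_left {y z : ℕ} {l : List ℕ} (hl : (y :: l).Pairwise (· ≥ ·)) (hz : y < z)
    (s : List ℕ) : InsEq (y :: (l ++ z :: s)) (y :: z :: (l ++ s)) := by
  induction l generalizing y with
  | nil => exact InsEq.refl _
  | cons x l ih =>
    rw [List.pairwise_cons] at hl
    have hxy : x ≤ y := hl.1 x (by simp)
    refine ((ih hl.2 (by omega)).cons y).trans ?_
    exact (KnuthTriple.right x y z hxy hz).insEq.symm.append_right (l ++ s)

/-- A letter smaller than a weakly decreasing word can be moved right to the second to last
position. -/
theorem insEq_move_right {x y : ℕ} {l : List ℕ} (hl : (l ++ [y]).Pairwise (· ≥ ·)) (hx : x < y)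
    (s : List ℕ) : InsEq (x :: (l ++ y :: s)) (l ++ x :: y :: s) := by
  induction l with
  | nil => exact InsEq.refl _
  | cons z l ih =>
    rw [List.cons_append, List.pairwise_cons] at hl
    refine InsEq.trans ?_ ((ih hl.2).cons z)
    rcases l with _ | ⟨y', l⟩
    · exact (KnuthTriple.left x y z hx (hl.1 y (by simp))).insEq.append_right s
    · have h1 : y ≤ y' := (List.pairwise_cons.1 hl.2).1 y (by simp)
      exact (KnuthTriple.left x y' z (by omega) (hl.1 y' (by simp))).insEq.append_right
        (l ++ y :: s)

/- ## Row words -/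

/-- The one-letter word `x`, or the empty word if `x = 0`. -/
def letter (x : ℕ) : List ℕ := if x = 0 then [] else [x]

/-- The word of the nonzero values of `g` at `n - 1, …, 0`. -/
def rowWord (g : ℕ → ℕ) : ℕ → List ℕ
  | 0 => []
  | n + 1 => letter (g n) ++ rowWord g n

theorem letter_zero : letter 0 = [] := rfl

theorem letter_of_ne {x : ℕ} (h : x ≠ 0) : letter x = [x] := by simp [letter, h]

theorem rowWord_eq (g : ℕ → ℕ) (n : ℕ) :
    rowWord g n = ((List.range n).reverse.map g).filter (fun x => x ≠ 0) := by
  induction n with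
  | zero => rfl
  | succ n ih =>
    rw [List.range_succ]
    by_cases h : g n = 0 <;> simp [rowWord, letter, h, ih]

theorem rowWord_congr {g h : ℕ → ℕ} {n : ℕ} (H : ∀ k < n, g k = h k) :
    rowWord g n = rowWord h n := by
  induction n with
  | zero => rfl
  | succ n ih => simp [rowWord, H n (by omega), ih fun k hk => H k (by omega)]

theorem rowWord_add (g : ℕ → ℕ) (m n : ℕ) :
    rowWord g (m + n) = rowWord (fun k => g (m + k)) n ++ rowWord g m := by
  induction n with
  | zero => rfl
  | succ n ih => rw [← Nat.add_assoc]; simp [rowWord, ih]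

theorem rowWord_succ' (g : ℕ → ℕ) (n : ℕ) :
    rowWord g (n + 1) = rowWord (fun k => g (k + 1)) n ++ letter (g 0) := by
  rw [Nat.add_comm, rowWord_add]
  simp [rowWord, Nat.add_comm]

theorem mem_rowWord {g : ℕ → ℕ} {n x : ℕ} (h : x ∈ rowWord g n) :
    x ≠ 0 ∧ ∃ k < n, g k = x := by
  induction n with
  | zero => simp [rowWord] at h
  | succ n ih =>
    rcases List.mem_append.1 h with h | h
    · by_cases h0 : g n = 0
      · simp [letter, h0] at h
      · simp [letter, h0] at h
        exact ⟨by omega, n, by omega, h.symm⟩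
    · obtain ⟨h1, k, hk, h2⟩ := ih h
      exact ⟨h1, k, by omega, h2⟩

theorem rowWord_eq_nil {g : ℕ → ℕ} {n : ℕ} (h : ∀ k < n, g k = 0) : rowWord g n = [] := by
  rw [List.eq_nil_iff_forall_not_mem]
  intro x hx
  obtain ⟨h1, k, hk, h2⟩ := mem_rowWord hx
  exact h1 (h2 ▸ h k hk)

theorem rowWord_pairwise {g : ℕ → ℕ} {n : ℕ}
    (hg : ∀ k k', k ≤ k' → k' < n → g k ≠ 0 → g k' ≠ 0 → g k ≤ g k') :
    (rowWord g n).Pairwise (· ≥ ·) := by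
  induction n with
  | zero => simp [rowWord]
  | succ n ih =>
    have := ih fun k k' h1 h2 => hg k k' h1 (by omega)
    by_cases h0 : g n = 0
    · simpa [rowWord, h0, letter_zero] using this
    · simp only [rowWord, letter_of_ne h0, List.singleton_append, List.pairwise_cons]
      refine ⟨fun x hx => ?_, this⟩
      obtain ⟨h1, k, hk, rfl⟩ := mem_rowWord hx
      exact hg k n hk.le (by omega) h1 h0

/-- Moving a letter `b` left across a row `g` lying above a row `h` whose entries are at
most `b`. -/
theorem insEq_slide_left {b n : ℕ} {g h : ℕ → ℕ}
    (hgh : ∀ k < n, g k ≠ 0 → h k ≠ 0 ∧ g k < h k)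
    (hh : ∀ k k', k ≤ k' → k' < n → h k ≠ 0 → h k' ≠ 0 → h k ≤ h k')
    (hb : ∀ k < n, h k ≤ b) (Y : List ℕ) :
    InsEq (rowWord g n ++ b :: (rowWord h n ++ Y)) (b :: (rowWord g n ++ (rowWord h n ++ Y))) := by
  induction n generalizing g h Y with
  | zero => exact InsEq.refl _
  | succ n ih =>
    have IH := fun Y => ih (g := fun k => g (k + 1)) (h := fun k => h (k + 1))
      (fun k hk => hgh (k + 1) (by omega))
      (fun k k' h1 h2 => hh (k + 1) (k' + 1) (by omega) (by omega))
      (fun k hk => hb (k + 1) (by omega)) Y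
    rw [rowWord_succ', rowWord_succ']
    by_cases hg0 : g 0 = 0
    · simpa [hg0, letter_zero] using IH (letter (h 0) ++ Y)
    · obtain ⟨hh0, hlt⟩ := hgh 0 (by omega) hg0
      have hdec : (rowWord (fun k => h (k + 1)) n ++ [h 0]).Pairwise (· ≥ ·) := by
        have := rowWord_pairwise hh
        rwa [rowWord_succ', letter_of_ne hh0] at this
      have hdec' : (b :: rowWord (fun k => h (k + 1)) n ++ [h 0]).Pairwise (· ≥ ·) := by
        rw [List.cons_append, List.pairwise_cons]
        refine ⟨fun x hx => ?_, hdec⟩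
        rcases List.mem_append.1 hx with hx | hx
        · obtain ⟨_, k, hk, rfl⟩ := mem_rowWord hx
          exact hb (k + 1) (by omega)
        · rw [List.mem_singleton.1 hx]
          exact hb 0 (by omega)
      have h1 := (insEq_move_right hdec' hlt Y).append_left (rowWord (fun k => g (k + 1)) n)
      have h2 := IH (g 0 :: h 0 :: Y)
      have h3 := ((insEq_move_right hdec hlt Y).append_left
        (rowWord (fun k => g (k + 1)) n)).cons b
      rw [letter_of_ne hg0, letter_of_ne hh0]
      simp only [List.append_assoc, List.cons_append, List.nil_append] at h1 h2 h3 ⊢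
      exact h1.trans (h2.trans h3.symm)

/-- Moving a letter `b` left across a row `h` lying below a row `g` whose entries are at
least `b`. -/
theorem insEq_slide_right {b n : ℕ} {g h : ℕ → ℕ} {U X : List ℕ}
    (hgh : ∀ k < n, h k ≠ 0 → g k ≠ 0 ∧ g k < h k)
    (hg : ∀ k k', k ≤ k' → k' < n → g k ≠ 0 → g k' ≠ 0 → g k ≤ g k')
    (hb : ∀ k < n, g k ≠ 0 → b ≤ g k)
    (hU : (b :: U).Pairwise (· ≥ ·))
    (hX : InsEq (U ++ b :: X) (b :: (U ++ X))) :
    InsEq (rowWord g n ++ (U ++ (rowWord h n ++ b :: X)))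
      (rowWord g n ++ b :: (U ++ (rowWord h n ++ X))) := by
  induction n with
  | zero => exact hX
  | succ n ih =>
    have IH := ih (fun k hk => hgh k (by omega)) (fun k k' h1 h2 => hg k k' h1 (by omega))
      (fun k hk => hb k (by omega))
    by_cases hn : h n = 0
    · simpa [rowWord, hn, letter_zero] using IH.append_left (letter (g n))
    · obtain ⟨hgn, hlt⟩ := hgh n (by omega) hn
      have hdec : (g n :: (rowWord g n ++ b :: U)).Pairwise (· ≥ ·) := by
        have h1 := rowWord_pairwise hg
        rw [rowWord, letter_of_ne hgn] at h1
        have h2 : (g n :: rowWord g n ++ b :: U).Pairwise (· ≥ ·) := by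
          refine List.pairwise_append.2 ⟨h1, hU, fun x hx y hy => ?_⟩
          have hbx : b ≤ x := by
            have : x ∈ rowWord g (n + 1) := by simpa [rowWord, letter_of_ne hgn] using hx
            obtain ⟨h0, k, hk, rfl⟩ := mem_rowWord this
            exact hb k hk h0
          rcases List.mem_cons.1 hy with rfl | hy
          · exact hbx
          · exact ((List.pairwise_cons.1 hU).1 y hy).trans hbx
        exact h2
      have hdec' : (g n :: (rowWord g n ++ U)).Pairwise (· ≥ ·) :=
        hdec.sublist (by simp)
      have h1 := insEq_move_left hdec' hlt (rowWord h n ++ b :: X)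
      have h2 := (IH.cons (h n)).cons (g n)
      have h3 := insEq_move_left hdec hlt (rowWord h n ++ X)
      simp only [rowWord, letter_of_ne hgn, letter_of_ne hn]
      simp only [List.append_assoc, List.cons_append, List.nil_append] at h1 h2 h3 ⊢
      exact h1.trans (h2.trans h3.symm)

/- ## Reading words -/

theorem readWordF_succ (R C : ℕ) (f : ℕ → ℕ → ℕ) :
    readWordF (R + 1) C f = readWordF R C f ++ rowWord (f R) C := by
  simp [readWordF, List.range_succ, rowWord_eq]

theorem readWordF_congr {R C : ℕ} {f f' : ℕ → ℕ → ℕ}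
    (h : ∀ a < R, rowWord (f a) C = rowWord (f' a) C) : readWordF R C f = readWordF R C f' := by
  induction R with
  | zero => rfl
  | succ R ih =>
    rw [readWordF_succ, readWordF_succ, h R (by omega), ih fun a ha => h a (by omega)]

theorem insEq_readWordF {R C i : ℕ} {f f' : ℕ → ℕ → ℕ} (hi : i + 1 < R)
    (h : ∀ a, a ≠ i → a ≠ i + 1 → f a = f' a)
    (hw : InsEq (rowWord (f i) C ++ rowWord (f (i + 1)) C)
      (rowWord (f' i) C ++ rowWord (f' (i + 1)) C)) :
    InsEq (readWordF R C f) (readWordF R C f') := by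
  induction R with
  | zero => omega
  | succ R ih =>
    rcases Nat.lt_or_ge (i + 1) R with hR | hR
    · rw [readWordF_succ, readWordF_succ, h R (by omega) (by omega)]
      exact (ih hR).append_right _
    · obtain rfl : R = i + 1 := by omega
      simp only [readWordF_succ, List.append_assoc]
      rw [readWordF_congr (f := f) (f' := f') fun a ha => by rw [h a (by omega) (by omega)]]
      exact hw.append_left _

/- ## Tableaux with holes and slides -/

/-- A semistandard filling of the skew shape `lam - rho` outside the set `H` of holes. -/
structure HoleTab (lam rho : ℕ → ℕ) (H : ℕ → ℕ → Prop) (f : ℕ → ℕ → ℕ) : Prop where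
  lam_anti : Antitone lam
  rho_anti : Antitone rho
  rho_le : ∀ a, rho a ≤ lam a
  supp : ∀ a b, f a b ≠ 0 ↔ rho a ≤ b ∧ b < lam a ∧ ¬ H a b
  row : ∀ a b b', b ≤ b' → f a b ≠ 0 → f a b' ≠ 0 → f a b ≤ f a b'
  col : ∀ a a' b, a < a' → f a b ≠ 0 → f a' b ≠ 0 → f a b < f a' b

/-- The single hole `(i, j)`. -/
def holeAt (i j : ℕ) : ℕ → ℕ → Prop := fun a b => a = i ∧ b = j

/-- No holes. -/
def noHole : ℕ → ℕ → Prop := fun _ _ => False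

theorem upd_upd_apply (f : ℕ → ℕ → ℕ) (i j i' j' v w a b : ℕ) :
    upd (upd f i j v) i' j' w a b =
      if a = i' ∧ b = j' then w else if a = i ∧ b = j then v else f a b := rfl

section Slide

variable {lam rho : ℕ → ℕ} {f : ℕ → ℕ → ℕ} {i j : ℕ}

theorem HoleTab.apply_hole (hf : HoleTab lam rho (holeAt i j) f) : f i j = 0 := by
  by_contra h
  exact ((hf.supp i j).1 h).2.2 ⟨rfl, rfl⟩

theorem HoleTab.ne_zero (hf : HoleTab lam rho (holeAt i j) f) {a b : ℕ} (h1 : rho a ≤ b)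
    (h2 : b < lam a) (h3 : a = i → b ≠ j) : f a b ≠ 0 :=
  (hf.supp a b).2 ⟨h1, h2, fun h => h3 h.1 h.2⟩

theorem HoleTab.move (hf : HoleTab lam rho (holeAt i j) f) (h1 : rho i ≤ j) (h2 : j < lam i)
    {i' j' : ℕ} (hx : f i' j' ≠ 0)
    (hl : ∀ b < j, f i b ≠ 0 → f i b ≤ f i' j')
    (hr : ∀ b > j, f i b ≠ 0 → (i = i' → b ≠ j') → f i' j' ≤ f i b)
    (hu : ∀ a < i, f a j ≠ 0 → f a j < f i' j')
    (hd : ∀ a > i, f a j ≠ 0 → (j = j' → a ≠ i') → f i' j' < f a j) :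
    HoleTab lam rho (holeAt i' j') (upd (upd f i j (f i' j')) i' j' 0) := by
  have h0 := hf.apply_hole
  refine ⟨hf.lam_anti, hf.rho_anti, hf.rho_le, fun a b => ?_, fun a b b' hb h h' => ?_,
    fun a a' b ha h h' => ?_⟩
  · have := hf.supp a b
    simp only [holeAt] at this ⊢
    rw [upd_upd_apply]
    split_ifs with c1 c2
    · simp [c1]
    · obtain ⟨rfl, rfl⟩ := c2
      simp [hx, h1, h2, c1]
    · rw [this]
      tauto
  · rw [upd_upd_apply] at h h' ⊢
    rw [upd_upd_apply]
    have n : ¬(a = i' ∧ b = j') := fun c => h (if_pos c)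
    have n' : ¬(a = i' ∧ b' = j') := fun c => h' (if_pos c)
    rw [if_neg n] at h ⊢
    rw [if_neg n'] at h' ⊢
    by_cases c : a = i ∧ b = j <;> by_cases c' : a = i ∧ b' = j
    · rw [if_pos c, if_pos c']
    · rw [if_neg c'] at h' ⊢
      rw [if_pos c]
      obtain ⟨rfl, rfl⟩ := c
      exact hr b' (by omega) h' (fun e e' => n' ⟨e, e'⟩)
    · rw [if_neg c] at h ⊢
      rw [if_pos c']
      obtain ⟨rfl, rfl⟩ := c'
      exact hl b (by omega) h
    · rw [if_neg c] at h ⊢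
      rw [if_neg c'] at h' ⊢
      exact hf.row a b b' hb h h'
  · rw [upd_upd_apply] at h h' ⊢
    rw [upd_upd_apply]
    have n : ¬(a = i' ∧ b = j') := fun c => h (if_pos c)
    have n' : ¬(a' = i' ∧ b = j') := fun c => h' (if_pos c)
    rw [if_neg n] at h ⊢
    rw [if_neg n'] at h' ⊢
    by_cases c : a = i ∧ b = j <;> by_cases c' : a' = i ∧ b = j
    · omega
    · rw [if_neg c'] at h' ⊢
      rw [if_pos c]
      obtain ⟨rfl, rfl⟩ := c
      exact hd a' ha h' (fun e e' => n' ⟨e', e⟩)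
    · rw [if_neg c] at h ⊢
      rw [if_pos c']
      obtain ⟨rfl, rfl⟩ := c'
      exact hu a ha h
    · rw [if_neg c] at h ⊢
      rw [if_neg c'] at h' ⊢
      exact hf.col a a' b ha h h'

theorem HoleTab.lt_of_left (hf : HoleTab lam rho (holeAt i j) f) (hb : f (i + 1) j ≠ 0) {b : ℕ}
    (hbj : b < j) (h : f i b ≠ 0) : f (i + 1) b ≠ 0 ∧ f i b < f (i + 1) b := by
  have s1 := (hf.supp i b).1 h
  have s2 := (hf.supp (i + 1) j).1 hb
  have a1 := hf.rho_anti (Nat.le_succ i)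
  have h' : f (i + 1) b ≠ 0 := hf.ne_zero (a1.trans s1.1) (by omega) (by omega)
  exact ⟨h', hf.col i (i + 1) b (by omega) h h'⟩

theorem HoleTab.le_of_right (hf : HoleTab lam rho (holeAt i j) f) (h1 : rho i ≤ j)
    (hr : f i (j + 1) = 0 ∨ f (i + 1) j ≤ f i (j + 1)) {b : ℕ} (hbj : j < b) (h : f i b ≠ 0) :
    f (i + 1) j ≤ f i b := by
  have s1 := (hf.supp i b).1 h
  have h' : f i (j + 1) ≠ 0 := hf.ne_zero (by omega) (by omega) (by omega)
  have := hf.row i (j + 1) b hbj h' h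
  have := hr.resolve_left h'
  omega

theorem HoleTab.move_up (hf : HoleTab lam rho (holeAt i j) f) (h1 : rho i ≤ j)
    (hb : f (i + 1) j ≠ 0) (hr : f i (j + 1) = 0 ∨ f (i + 1) j ≤ f i (j + 1)) :
    HoleTab lam rho (holeAt (i + 1) j) (upd (upd f i j (f (i + 1) j)) (i + 1) j 0) := by
  have s2 := (hf.supp (i + 1) j).1 hb
  refine hf.move h1 (s2.2.1.trans_le (hf.lam_anti (Nat.le_succ i))) hb (fun b hbj h => ?_)
    (fun b hbj h _ => hf.le_of_right h1 hr hbj h) (fun a ha h => hf.col a (i + 1) j (by omega) h hb)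
    (fun a ha h h' => hf.col (i + 1) a j (lt_of_le_of_ne ha (h' rfl).symm) hb h)
  have h3 := hf.lt_of_left hb hbj h
  exact h3.2.le.trans (hf.row (i + 1) b j hbj.le h3.1 hb)

theorem HoleTab.move_left (hf : HoleTab lam rho (holeAt i j) f) (h1 : rho i ≤ j)
    (hr : f i (j + 1) ≠ 0) (hb : f (i + 1) j = 0 ∨ f i (j + 1) < f (i + 1) j) :
    HoleTab lam rho (holeAt i (j + 1)) (upd (upd f i j (f i (j + 1))) i (j + 1) 0) := by
  have s2 := (hf.supp i (j + 1)).1 hr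
  refine hf.move h1 (by omega) hr (fun b hbj h => hf.row i b (j + 1) (by omega) h hr)
    (fun b hbj h h' => hf.row i (j + 1) b hbj hr h) (fun a ha h => ?_) (fun a ha h h' => ?_)
  · have s1 := (hf.supp a j).1 h
    have a1 := hf.lam_anti ha.le
    have h' : f a (j + 1) ≠ 0 := hf.ne_zero (by omega) (by omega) (by omega)
    exact (hf.row a j (j + 1) (by omega) h h').trans_lt (hf.col a i (j + 1) ha h' hr)
  · have s1 := (hf.supp a j).1 h
    have a1 := hf.lam_anti (show i + 1 ≤ a from ha)
    have a2 := hf.rho_anti (Nat.le_succ i)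
    have h3 : f (i + 1) j ≠ 0 := hf.ne_zero (a2.trans h1) (by omega) (by omega)
    refine (hb.resolve_left h3).trans_le ?_
    rcases eq_or_lt_of_le (show i + 1 ≤ a from ha) with rfl | h4
    · exact le_rfl
    · exact (hf.col (i + 1) a j h4 h3 h).le

theorem HoleTab.insEq_move_up {R C : ℕ} (hf : HoleTab lam rho (holeAt i j) f) (h1 : rho i ≤ j)
    (hb : f (i + 1) j ≠ 0) (hr : f i (j + 1) = 0 ∨ f (i + 1) j ≤ f i (j + 1))
    (hR : i + 1 < R) (hC : j < C) :
    InsEq (readWordF R C f)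
      (readWordF R C (upd (upd f i j (f (i + 1) j)) (i + 1) j 0)) := by
  refine insEq_readWordF hR (fun a h2 h3 => ?_) ?_
  · funext b
    simp [upd_upd_apply, h2, h3]
  obtain ⟨m, rfl⟩ : ∃ m, C = j + 1 + m := ⟨C - (j + 1), by omega⟩
  have split : ∀ g : ℕ → ℕ, rowWord g (j + 1 + m) =
      rowWord (fun k => g (j + 1 + k)) m ++ (letter (g j) ++ rowWord g j) := fun g => by
    rw [rowWord_add]; rfl
  have e1 : rowWord (upd (upd f i j (f (i + 1) j)) (i + 1) j 0 i) j = rowWord (f i) j :=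
    rowWord_congr fun k hk => by rw [upd_upd_apply, if_neg (by omega), if_neg (by omega)]
  have e2 : rowWord (upd (upd f i j (f (i + 1) j)) (i + 1) j 0 (i + 1)) j =
      rowWord (f (i + 1)) j :=
    rowWord_congr fun k hk => by rw [upd_upd_apply, if_neg (by omega), if_neg (by omega)]
  have e3 : (fun k => upd (upd f i j (f (i + 1) j)) (i + 1) j 0 i (j + 1 + k)) =
      fun k => f i (j + 1 + k) := by
    funext k; rw [upd_upd_apply, if_neg (by omega), if_neg (by omega)]
  have e4 : (fun k => upd (upd f i j (f (i + 1) j)) (i + 1) j 0 (i + 1) (j + 1 + k)) =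
      fun k => f (i + 1) (j + 1 + k) := by
    funext k; rw [upd_upd_apply, if_neg (by omega), if_neg (by omega)]
  have e5 : upd (upd f i j (f (i + 1) j)) (i + 1) j 0 i j = f (i + 1) j := by
    rw [upd_upd_apply, if_neg (by omega), if_pos ⟨rfl, rfl⟩]
  have e6 : upd (upd f i j (f (i + 1) j)) (i + 1) j 0 (i + 1) j = 0 := by
    rw [upd_upd_apply, if_pos ⟨rfl, rfl⟩]
  simp only [split, e1, e2, e3, e4, e5, e6, hf.apply_hole, letter_zero, letter_of_ne hb,
    List.nil_append, List.append_assoc, List.cons_append]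
  have hle : ∀ k < j, f (i + 1) k ≤ f (i + 1) j := fun k hk => by
    by_cases h : f (i + 1) k = 0
    · omega
    · exact hf.row (i + 1) k j hk.le h hb
  refine insEq_slide_right (fun k _ h => ?_)
    (fun k k' h2 _ => hf.row i (j + 1 + k) (j + 1 + k') (by omega))
    (fun k _ h => hf.le_of_right h1 hr (by omega) h) ?_ ?_
  · have s1 := (hf.supp (i + 1) (j + 1 + k)).1 h
    have a1 := hf.lam_anti (Nat.le_succ i)
    have h' : f i (j + 1 + k) ≠ 0 :=
      hf.ne_zero (by omega) (s1.2.1.trans_le a1) (by omega)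
    exact ⟨h', hf.col i (i + 1) _ (by omega) h' h⟩
  · refine List.pairwise_cons.2 ⟨fun x hx => ?_,
      rowWord_pairwise fun k k' h2 _ => hf.row i k k' h2⟩
    obtain ⟨h2, k, hk, rfl⟩ := mem_rowWord hx
    exact (hf.lt_of_left hb hk h2).2.le.trans (hle k hk)
  · simpa using insEq_slide_left (g := f i) (h := f (i + 1))
      (fun k hk h => hf.lt_of_left hb hk h) (fun k k' h2 _ => hf.row (i + 1) k k' h2) hle []

theorem readWordF_move_left {R C : ℕ} (h0 : f i j = 0) (hC : j + 1 < C) :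
    readWordF R C (upd (upd f i j (f i (j + 1))) i (j + 1) 0) = readWordF R C f := by
  refine readWordF_congr fun a _ => ?_
  rcases eq_or_ne a i with rfl | ha
  · obtain ⟨m, rfl⟩ : ∃ m, C = j + 2 + m := ⟨C - (j + 2), by omega⟩
    rw [rowWord_add, rowWord_add _ (j + 2)]
    congr 1
    · refine rowWord_congr fun k _ => ?_
      rw [upd_upd_apply, if_neg (by omega), if_neg (by omega)]
    · have : rowWord (upd (upd f a j (f a (j + 1))) a (j + 1) 0 a) j = rowWord (f a) j :=
        rowWord_congr fun k _ => by rw [upd_upd_apply, if_neg (by omega), if_neg (by omega)]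
      simp [rowWord, this, upd_upd_apply, h0, letter_zero]
  · refine rowWord_congr fun k _ => ?_
    rw [upd_upd_apply, if_neg (by omega), if_neg (by omega)]

theorem HoleTab.fill (hf : HoleTab lam rho (holeAt i j) f) (h1 : rho i ≤ j) (h2 : j < lam i)
    (hb : f (i + 1) j = 0) (hr : f i (j + 1) = 0) :
    HoleTab (Function.update lam i j) rho noHole f := by
  have hi : lam i = j + 1 := by
    by_contra h
    exact hf.ne_zero (a := i) (b := j + 1) (by omega) (by omega) (by omega) hr
  have hi' : lam (i + 1) ≤ j := by
    by_contra h
    exact hf.ne_zero (a := i + 1) (b := j) ((hf.rho_anti (Nat.le_succ i)).trans h1) (by omega)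
      (by omega) hb
  refine ⟨antitone_nat_of_succ_le fun a => ?_, hf.rho_anti, fun a => ?_, fun a b => ?_,
    hf.row, hf.col⟩
  · have := hf.lam_anti (Nat.le_succ a)
    simp only [Function.update_apply]
    split_ifs with c1 c2 c2
    · omega
    · subst c1
      simp only [Nat.succ_eq_add_one] at this
      omega
    · subst c2
      exact hi'
    · exact this
  · rw [Function.update_apply]
    split_ifs with c
    · rwa [c]
    · exact hf.rho_le a
  · rw [hf.supp, Function.update_apply]
    simp only [holeAt, noHole, not_false_eq_true, and_true]
    split_ifs with c
    · subst c
      omega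
    · tauto

end Slide

theorem slideU_spec {lam rho : ℕ → ℕ} {R C : ℕ} (hR : ∀ a, lam a ≠ 0 → a < R)
    (hC : ∀ a, lam a ≤ C) (fuel : ℕ) {f : ℕ → ℕ → ℕ} {i j : ℕ}
    (hf : HoleTab lam rho (holeAt i j) f) (h1 : rho i ≤ j) (h2 : j < lam i)
    (hfuel : R + C ≤ i + j + fuel) :
    ∃ lam', (∀ a, lam' a ≤ lam a) ∧ HoleTab lam' rho noHole (slideU fuel f i j).1 ∧
      InsEq (readWordF R C f) (readWordF R C (slideU fuel f i j).1) := by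
  induction fuel generalizing f i j with
  | zero =>
    have := hR i (by omega)
    have := hC i
    omega
  | succ fuel ih =>
    by_cases hbr : f (i + 1) j = 0 ∧ f i (j + 1) = 0
    · refine ⟨Function.update lam i j, fun a => ?_, ?_, ?_⟩
      · rcases eq_or_ne a i with rfl | ha
        · simpa using h2.le
        · simp [ha]
      · simpa [slideU, hbr] using hf.fill h1 h2 hbr.1 hbr.2
      · simpa [slideU, hbr] using InsEq.refl _
    · by_cases hb : f (i + 1) j ≠ 0 ∧ (f i (j + 1) = 0 ∨ f (i + 1) j ≤ f i (j + 1))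
      · have hs := (hf.supp (i + 1) j).1 hb.1
        have e : slideU (fuel + 1) f i j =
            slideU fuel (upd (upd f i j (f (i + 1) j)) (i + 1) j 0) (i + 1) j := by
          rw [slideU]
          rw [if_neg hbr, if_pos hb]
        obtain ⟨lam', h3, h4, h5⟩ := ih (hf.move_up h1 hb.1 hb.2) hs.1 hs.2.1 (by omega)
        rw [e]
        exact ⟨lam', h3, h4, (hf.insEq_move_up h1 hb.1 hb.2 (hR _ (by omega))
          (h2.trans_le (hC i))).trans h5⟩
      · have hr : f i (j + 1) ≠ 0 := by tauto
        have hs := (hf.supp i (j + 1)).1 hr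
        have hb' : f (i + 1) j = 0 ∨ f i (j + 1) < f (i + 1) j := by
          by_contra! h
          exact hb ⟨h.1, Or.inr h.2⟩
        have e : slideU (fuel + 1) f i j =
            slideU fuel (upd (upd f i j (f i (j + 1))) i (j + 1) 0) i (j + 1) := by
          rw [slideU]
          rw [if_neg hbr, if_neg hb]
        obtain ⟨lam', h3, h4, h5⟩ := ih (hf.move_left h1 hr hb') hs.1 hs.2.1 (by omega)
        rw [readWordF_move_left hf.apply_hole (hs.2.1.trans_le (hC i))] at h5
        rw [e]
        exact ⟨lam', h3, h4, h5⟩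

theorem HoleTab.shrink {lam rho : ℕ → ℕ} {f : ℕ → ℕ → ℕ} {i : ℕ}
    (hf : HoleTab lam rho noHole f) (hi : rho i ≠ 0) (hi' : rho (i + 1) = 0) :
    HoleTab lam (Function.update rho i (rho i - 1)) (holeAt i (rho i - 1)) f := by
  refine ⟨hf.lam_anti, antitone_nat_of_succ_le fun a => ?_, fun a => ?_, fun a b => ?_,
    hf.row, hf.col⟩
  · have := hf.rho_anti (Nat.le_succ a)
    simp only [Function.update_apply]
    split_ifs with c1 c2 c2
    · omega
    · subst c1
      simp only [Nat.succ_eq_add_one] at this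
      omega
    · subst c2
      omega
    · exact this
  · have := hf.rho_le a
    rw [Function.update_apply]
    split_ifs with c
    · subst c
      omega
    · exact this
  · have := hf.rho_le a
    rw [hf.supp, Function.update_apply]
    simp only [holeAt, noHole, not_false_eq_true, and_true]
    split_ifs with c
    · subst c
      omega
    · tauto

/- ## Insertion of the reading word of a straight tableau -/

theorem insertCol_append_lt {a : ℕ} {c : List ℕ} (h : ∀ x ∈ c, x < a) :
    insertCol a c = (none, c ++ [a]) := by
  induction c with
  | nil => rfl
  | cons e es ih =>
    have he : ¬ a ≤ e := not_le.2 (h e (by simp))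
    simp [insertCol, he, ih fun x hx => h x (by simp [hx])]

theorem insertCol_append_le {a z : ℕ} {c : List ℕ} (h : ∀ x ∈ c, x < a) (haz : a ≤ z) :
    insertCol a (c ++ [z]) = (some z, c ++ [a]) := by
  induction c with
  | nil => simp [insertCol, haz]
  | cons e es ih =>
    have he : ¬ a ≤ e := not_le.2 (h e (by simp))
    simp [insertCol, he, ih fun x hx => h x (by simp [hx])]

theorem passCol_row {a : ℕ} {l c : List ℕ} (hl : (l ++ [a]).Pairwise (· ≥ ·))
    (hc : ∀ x ∈ c, x < a) : passCol (l ++ [a]) c = (c ++ [a], l) := by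
  have key : ∀ (l : List ℕ) (z : ℕ), (z :: l ++ [a]).Pairwise (· ≥ ·) →
      passCol (l ++ [a]) (c ++ [z]) = (c ++ [a], z :: l) := by
    intro l
    induction l with
    | nil =>
      intro z hz
      have : a ≤ z := by simpa using hz
      simp [passCol, insertCol_append_le hc this]
    | cons y l ih =>
      intro z hz
      rw [List.cons_append, List.pairwise_cons] at hz
      have hy : a ≤ y := (List.pairwise_cons.1 hz.2).1 a (by simp)
      have hyz : y ≤ z := hz.1 y (by simp)
      simp [passCol, insertCol_append_le (fun x hx => (hc x hx).trans_le hy) hyz, ih y hz.2]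
  rcases l with _ | ⟨y, l⟩
  · simp [passCol, insertCol_append_lt hc]
  · have hy : a ≤ y := (List.pairwise_cons.1 hl).1 a (by simp)
    simp [passCol, insertCol_append_lt fun x hx => (hc x hx).trans_le hy, key l y hl]

/-- The word of the nonzero entries of the first column of `f`, from top to bottom. -/
def firstCol (f : ℕ → ℕ → ℕ) : ℕ → List ℕ
  | 0 => []
  | R + 1 => firstCol f R ++ letter (f R 0)

theorem mem_firstCol {f : ℕ → ℕ → ℕ} {R x : ℕ} (h : x ∈ firstCol f R) :
    x ≠ 0 ∧ ∃ a < R, f a 0 = x := by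
  induction R with
  | zero => simp [firstCol] at h
  | succ R ih =>
    rcases List.mem_append.1 h with h | h
    · obtain ⟨h1, a, ha, h2⟩ := ih h
      exact ⟨h1, a, by omega, h2⟩
    · by_cases h0 : f R 0 = 0
      · simp [letter, h0] at h
      · simp [letter, h0] at h
        exact ⟨by omega, R, by omega, h.symm⟩

theorem passCol_readWordF {lam : ℕ → ℕ} {f : ℕ → ℕ → ℕ}
    (hf : HoleTab lam (fun _ => 0) noHole f) (R C : ℕ) :
    passCol (readWordF R (C + 1) f) [] =
      (firstCol f R, readWordF R C (fun a b => f a (b + 1))) := by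
  induction R with
  | zero => rfl
  | succ R ih =>
    rw [readWordF_succ, passCol_append, ih, readWordF_succ, firstCol]
    by_cases h0 : f R 0 = 0
    · have hz : ∀ b, f R b = 0 := by
        intro b
        by_contra h
        have := (hf.supp R b).1 h
        exact (hf.supp R 0).2 ⟨le_rfl, by omega, id⟩ h0
      rw [rowWord_eq_nil fun k _ => hz k, rowWord_eq_nil fun k _ => hz (k + 1), h0]
      simp [passCol, letter_zero]
    · have hp := rowWord_pairwise (g := f R) (n := C + 1) fun k k' h _ => hf.row R k k' h
      rw [rowWord_succ', letter_of_ne h0] at hp ⊢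
      rw [passCol_row hp fun x hx => ?_]
      obtain ⟨h1, a, ha, rfl⟩ := mem_firstCol hx
      exact hf.col a R 0 ha h1 h0

theorem firstCol_getD {lam : ℕ → ℕ} {f : ℕ → ℕ → ℕ}
    (hf : HoleTab lam (fun _ => 0) noHole f) {R : ℕ} (hR : ∀ a, lam a ≠ 0 → a < R) (i : ℕ) :
    (firstCol f R).getD i 0 = f i 0 := by
  have hz : ∀ a b, a ≤ b → f a 0 = 0 → f b 0 = 0 := fun a b hab h => by
    by_contra h'
    have := (hf.supp b 0).1 h'
    exact (hf.supp a 0).2 ⟨le_rfl, this.2.1.trans_le (hf.lam_anti hab), id⟩ h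
  have key : ∀ R, (firstCol f R).getD i 0 = if i < R then f i 0 else 0 := by
    have hlen : ∀ R, f R 0 ≠ 0 → (firstCol f R).length = R := by
      intro R
      induction R with
      | zero => intro _; rfl
      | succ R ih =>
        intro h
        have h' : f R 0 ≠ 0 := fun h0 => h (hz R _ (Nat.le_succ R) h0)
        simp [firstCol, letter_of_ne h', ih h']
    intro R
    induction R with
    | zero => simp [firstCol]
    | succ R ih =>
      by_cases h0 : f R 0 = 0
      · rw [firstCol, h0, letter_zero, List.append_nil, ih]
        split_ifs with c1 c2 c2
        · rfl
        · omega
        · rw [hz R i (by omega) h0]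
        · rfl
      · have hl := hlen R h0
        rw [firstCol, letter_of_ne h0]
        rcases lt_trichotomy i R with h | rfl | h
        · rw [List.getD_append _ _ _ _ (by omega), ih, if_pos h, if_pos (by omega)]
        · rw [List.getD_append_right _ _ _ _ (by omega)]
          simp [hl]
        · rw [List.getD_eq_default _ _ (by simp; omega), if_neg (by omega)]
  rw [key R]
  split_ifs with c
  · rfl
  · by_contra h
    have := (hf.supp i 0).1 (Ne.symm h)
    exact c (hR i (by omega))

theorem colsToFn_insertList_nil (w : List ℕ) :
    colsToFn (insertList w []) =
      colsToFn ((passCol w []).1 :: insertList (passCol w []).2 []) := by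
  rcases w with _ | ⟨a, w⟩
  · funext i j
    rcases j with _ | j <;> simp [colsToFn, insertList, passCol]
  · rw [insertList_nil_eq]

theorem colsToFn_straight {lam : ℕ → ℕ} {f : ℕ → ℕ → ℕ}
    (hf : HoleTab lam (fun _ => 0) noHole f) {R C : ℕ} (hR : ∀ a, lam a ≠ 0 → a < R)
    (hC : ∀ a, lam a ≤ C) : colsToFn (insertList (readWordF R C f) []) = f := by
  induction C generalizing lam f with
  | zero =>
    have hz : ∀ a b, f a b = 0 := fun a b => by
      by_contra h
      have := (hf.supp a b).1 h
      have := hC a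
      omega
    have hw : readWordF R 0 f = [] := by
      clear hR
      induction R with
      | zero => rfl
      | succ R ih => rw [readWordF_succ, ih]; rfl
    funext a b
    rw [hw, hz]
    simp [insertList, colsToFn]
  | succ C ih =>
    have hf' : HoleTab (fun a => lam a - 1) (fun _ => 0) noHole (fun a b => f a (b + 1)) := by
      refine ⟨fun a b h => Nat.sub_le_sub_right (hf.lam_anti h) 1, fun _ _ _ => le_rfl,
        fun _ => Nat.zero_le _, fun a b => ?_, fun a b b' h => hf.row a _ _ (by omega),
        fun a a' b h => hf.col a a' _ h⟩
      rw [hf.supp]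
      simp only [noHole, not_false_eq_true, and_true]
      omega
    have IH := ih hf' (fun a ha => hR a (by omega)) (fun a => by have := hC a; omega)
    rw [colsToFn_insertList_nil, passCol_readWordF hf]
    funext a b
    rcases b with _ | b
    · simpa [colsToFn] using firstCol_getD hf hR a
    · exact congrFun (congrFun IH a) b

/- ## Rectification -/

theorem sum_set_pred {l : List ℕ} {i : ℕ} (h : l.getD i 0 ≠ 0) :
    (l.set i (l.getD i 0 - 1)).sum + 1 = l.sum := by
  induction l generalizing i with
  | nil => simp at h
  | cons x l ih =>
    rcases i with _ | i
    · simp at h ⊢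
      omega
    · simp only [List.getD_cons_succ, List.set_cons_succ, List.sum_cons] at h ⊢
      have := ih h
      omega

theorem getD_set_eq_update (l : List ℕ) {i : ℕ} (hi : i < l.length) (v : ℕ) :
    (fun a => (l.set i v).getD a 0) = Function.update (fun a => l.getD a 0) i v := by
  funext a
  rcases eq_or_ne a i with rfl | h
  · simp [hi]
  · simp [h, List.getD_eq_getElem?_getD, List.getElem?_set_ne h.symm]

theorem rectify_spec {R C B : ℕ} (hB : R + C ≤ B) (fuel : ℕ) {lam : ℕ → ℕ}
    {lamL rho : List ℕ} {f : ℕ → ℕ → ℕ} (hlen : lamL.length = R)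
    (hR : ∀ a, lam a ≠ 0 → a < R) (hC : ∀ a, lam a ≤ C)
    (hf : HoleTab lam (fun a => rho.getD a 0) noHole f) (hfuel : rho.sum < fuel) :
    rectify B fuel lamL rho f = colsToFn (insertList (readWordF R C f) []) := by
  induction fuel generalizing lam lamL rho f with
  | zero => omega
  | succ fuel ih =>
    have hrhoR : ∀ a, R ≤ a → rho.getD a 0 = 0 := fun a ha => by
      by_contra h
      have h1 := hf.rho_le a
      have h2 := hR a
      omega
    rw [rectify]
    split
    next h =>
      rw [List.max?_eq_none_iff, List.filter_eq_nil_iff] at h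
      have hz : (fun a => rho.getD a 0) = fun _ => 0 := by
        funext a
        by_cases ha : a < R
        · have := h a (by simpa [hlen] using ha)
          simpa using this
        · exact hrhoR a (by omega)
      rw [hz] at hf
      exact (colsToFn_straight hf hR hC).symm
    next i h =>
      obtain ⟨hmem, hmax⟩ := List.max?_eq_some_iff.1 h
      have hi : rho.getD i 0 ≠ 0 := by
        have := (List.mem_filter.1 hmem).2
        simp only [decide_eq_true_eq] at this
        omega
      have hi' : rho.getD (i + 1) 0 = 0 := by
        by_contra h0
        have h1 : i + 1 < R := by
          by_contra h2
          exact h0 (hrhoR _ (by omega))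
        have := hmax (i + 1) (List.mem_filter.2 ⟨by simpa [hlen] using h1,
          decide_eq_true (Nat.pos_of_ne_zero h0)⟩)
        omega
      have hil : i < rho.length := by
        by_contra h0
        exact hi (List.getD_eq_default _ _ (by omega))
      have hs := hf.shrink hi hi'
      have hle := hf.rho_le i
      obtain ⟨lam', h1, h2, h3⟩ := slideU_spec hR hC B hs (by simp) (by omega) (by omega)
      rw [h3 [] (by simp [ColsStrict])]
      refine ih (by simp [hlen]) (fun a ha => hR a ?_) (fun a => (h1 a).trans (hC a)) ?_ ?_
      · have := h1 a
        omega
      · rwa [getD_set_eq_update rho hil]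
      · have := sum_set_pred hi
        omega

theorem IsPartition.antitone_getD {l : List ℕ} (hl : IsPartition l) :
    Antitone fun a => l.getD a 0 := by
  refine antitone_nat_of_succ_le fun a => ?_
  by_cases h : a + 1 < l.length
  · have := List.isChain_iff_getElem.1 hl.1 a h
    rwa [← List.getD_eq_getElem _ 0 h, ← List.getD_eq_getElem _ 0 (Nat.lt_of_succ_lt h)] at this
  · rw [List.getD_eq_default _ _ (by omega)]
    exact Nat.zero_le _

theorem IsSkewFn.holeTab {lam rho : List ℕ} {f : ℕ → ℕ → ℕ} (hlam : IsPartition lam)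
    (hrho : IsPartition rho) (hsub : ∀ i, rho.getD i 0 ≤ lam.getD i 0)
    (hf : IsSkewFn lam rho f) :
    HoleTab (fun a => lam.getD a 0) (fun a => rho.getD a 0) noHole f := by
  obtain ⟨h1, h2, h3⟩ := hf
  have al := hlam.antitone_getD
  have ar := hrho.antitone_getD
  refine ⟨al, ar, hsub, fun a b => ?_, fun a b b' hb h h' => ?_, fun a a' b ha h h' => ?_⟩
  · rw [h1]
    simp [noHole]
  · exact h2 a b b' ((h1 a b).1 h).1 hb ((h1 a b').1 h').2
  · induction a', ha using Nat.le_induction with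
    | base => exact h3 a b h h'
    | succ a' ha ih =>
      have h4 : f a' b ≠ 0 := (h1 a' b).2 ⟨(ar (Nat.le_of_succ_le ha)).trans ((h1 a b).1 h).1,
        ((h1 _ b).1 h').2.trans_le (al (Nat.le_succ a'))⟩
      exact (ih h4).trans (h3 a' b h4 h')

end DK

/-- Theorem 1.4.2: the jeu de taquin rectification of a skew semistandard
tableau coincides with the column insertion of its reading word into the
empty tableau: `jdt(T) = [w(T) → ∅]`. -/
theorem rect_eq_insert_readWord (lam rho : List ℕ) (f : ℕ → ℕ → ℕ)
    (hlam : DK.IsPartition lam)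
    (hrho : DK.IsPartition rho)
    (hsub : ∀ i, rho.getD i 0 ≤ lam.getD i 0)
    (hf : DK.IsSkewFn lam rho f) :
    DK.rect lam rho f =
      DK.colsToFn (DK.insertList (DK.readWordF lam.length (lam.headD 0) f) []) := by
  have h := hf.holeTab hlam hrho hsub
  refine DK.rectify_spec (Nat.le_succ _) _ rfl (fun a ha => ?_) (fun a => ?_) h
    (Nat.lt_succ_self _)
  · by_contra h0
    exact ha (List.getD_eq_default _ _ (by omega))
  · refine (h.lam_anti (Nat.zero_le a)).trans ?_
    cases lam <;> simp
end
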